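/- arXiv:2009.05691 — 2 statements merged into one kernel-verified Lean document; each statement's English description precedes it below -/
import Mathlib

section
/- Let G be a graph with no long theta, and let K be a tidy shortest long near-prism in G with constituent paths P1, P2, P3. Let x, y, z be K-major vertices such that y and z are both distant from x. If there exist i, j ∈ {1,2,3} such that y has no neighbour in V(P_i) and z has no neighbour in V(P_j), then i = j. -/
open SimpleGraph

namespace LEH

open scoped Classical

variable {V : Type*}

/-- `X` is anticomplete to `Y`: they are disjoint and there are no edges between them. -/
def Anticomplete (G : SimpleGraph V) (X Y : Set V) : Prop :=
  ∀ ⦃x⦄, x ∈ X → ∀ ⦃y⦄, y ∈ Y → x ≠ y ∧ ¬ G.Adj x y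

/-- The vertex set of a walk. -/
def vset {G : SimpleGraph V} {u v : V} (P : G.Walk u v) : Set V :=
  {x | x ∈ P.support}

/-- The interior of a path: its non-end vertices. -/
def inter {G : SimpleGraph V} {u v : V} (P : G.Walk u v) : Set V :=
  {x | x ∈ P.support ∧ x ≠ u ∧ x ≠ v}

/-- An induced path in `G`. -/
def IsInducedPath {G : SimpleGraph V} {u v : V} (P : G.Walk u v) : Prop :=
  P.IsPath ∧ ∀ x ∈ P.support, ∀ y ∈ P.support, G.Adj x y → s(x, y) ∈ P.edges

/-- A hole: an induced cycle of length at least 4. -/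
def IsHole {G : SimpleGraph V} {u : V} (c : G.Walk u u) : Prop :=
  c.IsCycle ∧ 4 ≤ c.length ∧
    ∀ x ∈ c.support, ∀ y ∈ c.support, G.Adj x y → s(x, y) ∈ c.edges

/-- A long even hole: a hole of even length at least `ℓ`. -/
def IsLongEvenHole (ℓ : ℕ) {G : SimpleGraph V} {u : V} (c : G.Walk u u) : Prop :=
  IsHole c ∧ ℓ ≤ c.length ∧ Even c.length

def HasLongEvenHole (G : SimpleGraph V) (ℓ : ℕ) : Prop :=
  ∃ (u : V) (c : G.Walk u u), IsLongEvenHole ℓ c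

/-- A long theta in `G`: two nonadjacent vertices joined by three internally disjoint
induced paths with no edges between their interiors, any two of which form a long hole. -/
def HasLongTheta (G : SimpleGraph V) (ℓ : ℕ) : Prop :=
  ∃ (u v : V) (P₁ P₂ P₃ : G.Walk u v),
    u ≠ v ∧ ¬ G.Adj u v ∧
    IsInducedPath P₁ ∧ IsInducedPath P₂ ∧ IsInducedPath P₃ ∧
    Anticomplete G (inter P₁) (inter P₂) ∧
    Anticomplete G (inter P₁) (inter P₃) ∧
    Anticomplete G (inter P₂) (inter P₃) ∧
    ℓ ≤ P₁.length + P₂.length ∧ ℓ ≤ P₁.length + P₃.length ∧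
    ℓ ≤ P₂.length + P₃.length

/-- A long jewel of order `k` formed by `Q₁, Q₂, P`. -/
def IsLongJewel (ℓ k : ℕ) {G : SimpleGraph V} {u v : V}
    (Q₁ Q₂ P : G.Walk u v) : Prop :=
  u ≠ v ∧
  IsInducedPath Q₁ ∧ IsInducedPath Q₂ ∧ IsInducedPath P ∧
  ¬ (Even Q₁.length ↔ Even Q₂.length) ∧
  max Q₁.support.length Q₂.support.length = k ∧
  ℓ ≤ P.length + min Q₁.length Q₂.length ∧
  Anticomplete G (inter P) (inter Q₁ ∪ inter Q₂)

def HasLongJewel (G : SimpleGraph V) (ℓ k : ℕ) : Prop :=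
  ∃ (u v : V) (Q₁ Q₂ P : G.Walk u v), IsLongJewel ℓ k Q₁ Q₂ P

/-- A long ban-the-bomb in `G`. -/
def IsLongBanTheBomb (ℓ : ℕ) {G : SimpleGraph V} (u v₁ w v₂ x : V)
    (P₁ : G.Walk x v₁) (P₂ : G.Walk x v₂) : Prop :=
  G.Adj u v₁ ∧ G.Adj v₁ w ∧ G.Adj w v₂ ∧ G.Adj v₂ u ∧ ¬ G.Adj v₁ v₂ ∧ u ≠ w ∧
  G.Adj x u ∧ ¬ G.Adj x v₁ ∧ ¬ G.Adj x v₂ ∧ ¬ G.Adj x w ∧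
  x ≠ v₁ ∧ x ≠ v₂ ∧ x ≠ w ∧
  IsInducedPath P₁ ∧ IsInducedPath P₂ ∧
  2 ≤ P₁.length ∧ 2 ≤ P₂.length ∧
  Anticomplete G (inter P₁) {u, w} ∧ Anticomplete G (inter P₂) {u, w} ∧
  Anticomplete G (vset P₁ \ {x}) (vset P₂ \ {x}) ∧
  ℓ ≤ P₁.length + 2 ∧ ℓ ≤ P₂.length + 2 ∧ ℓ ≤ P₁.length + P₂.length + 2

def HasLongBanTheBomb (G : SimpleGraph V) (ℓ : ℕ) : Prop :=
  ∃ (u v₁ w v₂ x : V) (P₁ : G.Walk x v₁) (P₂ : G.Walk x v₂),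
    IsLongBanTheBomb ℓ u v₁ w v₂ x P₁ P₂

/-- The induced subgraph of `G` on the vertex set `S` is a long hole. -/
def IsLongHoleOn (G : SimpleGraph V) (ℓ : ℕ) (S : Set V) : Prop :=
  ∃ (u : V) (c : G.Walk u u), IsHole c ∧ ℓ ≤ c.length ∧ {x | x ∈ c.support} = S

/-- A long near-prism with triangles `{a 0, a 1, a 2}`, `{b 0, b 1, b 2}` and
constituent paths `P 0, P 1, P 2`. -/
def IsLongNearPrism (ℓ : ℕ) {G : SimpleGraph V} (a b : Fin 3 → V)
    (P : ∀ i : Fin 3, G.Walk (a i) (b i)) : Prop :=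
  (∀ i j, i ≠ j → G.Adj (a i) (a j)) ∧
  (∀ i j, i ≠ j → G.Adj (b i) (b j)) ∧
  (Set.range a ∩ Set.range b).Subsingleton ∧
  (∀ i, (P i).IsPath) ∧
  (∀ i j, i ≠ j → ∀ x, x ∈ (P i).support → x ∉ (P j).support) ∧
  (∀ i j, i ≠ j → IsLongHoleOn G ℓ (vset (P i) ∪ vset (P j)))

def HasLongNearPrism (G : SimpleGraph V) (ℓ : ℕ) : Prop :=
  ∃ (a b : Fin 3 → V) (P : ∀ i : Fin 3, G.Walk (a i) (b i)), IsLongNearPrism ℓ a b P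

/-- A prospect: no long even hole of length at most `2ℓ`, no long jewel of order at most
`ℓ+1`, no long theta and no long ban-the-bomb. -/
def Prospect (G : SimpleGraph V) (ℓ : ℕ) : Prop :=
  (¬ ∃ (u : V) (c : G.Walk u u), IsLongEvenHole ℓ c ∧ c.length ≤ 2 * ℓ) ∧
  (¬ ∃ k ≤ ℓ + 1, HasLongJewel G ℓ k) ∧
  ¬ HasLongTheta G ℓ ∧ ¬ HasLongBanTheBomb G ℓ

/-- A candidate : a prospect with no long near-prism. -/
def Candidate (G : SimpleGraph V) (ℓ : ℕ) : Prop :=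
  Prospect G ℓ ∧ ¬ HasLongNearPrism G ℓ

/-- The vertex set of a near-prism. -/
def prismSupport {G : SimpleGraph V} {a b : Fin 3 → V}
    (P : ∀ i : Fin 3, G.Walk (a i) (b i)) : Set V :=
  ⋃ i, vset (P i)

/-- The near-prism, as a graph on `V`. -/
def prismGraph (G : SimpleGraph V) (a b : Fin 3 → V)
    (P : ∀ i : Fin 3, G.Walk (a i) (b i)) : SimpleGraph V :=
  SimpleGraph.fromEdgeSet
    ({e | ∃ i j, i ≠ j ∧ e = s(a i, a j)} ∪ {e | ∃ i j, i ≠ j ∧ e = s(b i, b j)} ∪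
      {e | ∃ i, e ∈ (P i).edges})

/-- `q` is `K`-major: `q` is outside the near-prism `K`, and no path of `K` with at most
three vertices contains all neighbours of `q` in `V(K)`. -/
def KMajor (G : SimpleGraph V) {a b : Fin 3 → V}
    (P : ∀ i : Fin 3, G.Walk (a i) (b i)) (q : V) : Prop :=
  q ∉ prismSupport P ∧
  ¬ ∃ (x y : V) (W : (prismGraph G a b P).Walk x y), W.IsPath ∧ W.length ≤ 2 ∧
      ∀ z ∈ prismSupport P, G.Adj q z → z ∈ W.support

/-- A shortest long near-prism. -/
def ShortestLNP (G : SimpleGraph V) (ℓ : ℕ) {a b : Fin 3 → V}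
    (P : ∀ i : Fin 3, G.Walk (a i) (b i)) : Prop :=
  IsLongNearPrism ℓ a b P ∧
  ∀ (a' b' : Fin 3 → V) (P' : ∀ i : Fin 3, G.Walk (a' i) (b' i)),
    IsLongNearPrism ℓ a' b' P' → (prismSupport P).ncard ≤ (prismSupport P').ncard

/-- The interior `F_K*` of the frame of a long near-prism: for each constituent path,
either the whole path (if it has length at most `ℓ-1`), or the non-end vertices of the
two stubs of length `ℓ/2 - 1` at its two ends. -/
def frameStar (ℓ : ℕ) {G : SimpleGraph V} {a b : Fin 3 → V}
    (P : ∀ i : Fin 3, G.Walk (a i) (b i)) : Set V :=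
  ⋃ i,
    if (P i).length ≤ ℓ - 1 then vset (P i)
    else {x | x ∈ (P i).support.take (ℓ / 2 - 1)} ∪
      {x | x ∈ (P i).support.reverse.take (ℓ / 2 - 1)}

/-- A long near-prism is tidy: it contains a frame (so at most one constituent path has
length at most `ℓ-1`) whose interior is anticomplete to the rest of the graph. -/
def Tidy (G : SimpleGraph V) (ℓ : ℕ) {a b : Fin 3 → V}
    (P : ∀ i : Fin 3, G.Walk (a i) (b i)) : Prop :=
  (∀ i j, (P i).length ≤ ℓ - 1 → (P j).length ≤ ℓ - 1 → i = j) ∧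
  Anticomplete G (frameStar ℓ P) {x | x ∉ prismSupport P}

/-- The index of the first neighbour of `x` in the list `l`. -/
noncomputable def firstNbrIdx (G : SimpleGraph V) (l : List V) (x : V) : ℕ :=
  l.findIdx (fun y => decide (G.Adj x y))

/-- `α(x)`: the neighbour of `x` on `P` nearest to the first end of `P`. -/
noncomputable def alpha (G : SimpleGraph V) {u w : V} (P : G.Walk u w) (x : V) : V :=
  P.support.getD (firstNbrIdx G P.support x) u

/-- `β(x)`: the neighbour of `x` on `P` nearest to the last end of `P`. -/
noncomputable def beta (G : SimpleGraph V) {u w : V} (P : G.Walk u w) (x : V) : V :=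
  P.support.reverse.getD (firstNbrIdx G P.support.reverse x) w

/-- `A(x)`: the vertex set of the subpath of `P` from its first end to `α(x)` if `x` has
a neighbour on `P`, and all of `V(P)` otherwise. -/
noncomputable def Aset (G : SimpleGraph V) {u w : V} (P : G.Walk u w) (x : V) : Set V :=
  if ∃ y ∈ P.support, G.Adj x y then
    {z | z ∈ P.support.take (firstNbrIdx G P.support x + 1)}
  else vset P

noncomputable def A123 (G : SimpleGraph V) {a b : Fin 3 → V}
    (P : ∀ i : Fin 3, G.Walk (a i) (b i)) (x : V) : Set V :=
  ⋃ i, Aset G (P i) x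

/-- The index of `v` in the list `l`. -/
noncomputable def listIdx (l : List V) (v : V) : ℕ :=
  l.findIdx (fun z => decide (z = v))

/-- `K^m_n(v)`: the union of the maximal subpath of `P` from `v` towards the first end of
`P` of length at most `m` with no internal vertex in `Fs`, and the maximal subpath of `P`
from `v` towards the last end of `P` of length at most `n` with no internal vertex in `Fs`. -/
noncomputable def Kmn (G : SimpleGraph V) (Fs : Set V) {u w : V}
    (P : G.Walk u w) (v : V) (m n : ℕ) : Set V :=
  let t := listIdx P.support v
  {z | ∃ r, r ≤ t ∧ t - r ≤ m ∧
      (∀ q, r < q → q < t → P.support.getD q v ∉ Fs) ∧ z = P.support.getD r v} ∪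
  {z | ∃ r, t ≤ r ∧ r < P.support.length ∧ r - t ≤ n ∧
      (∀ q, t < q → q < r → P.support.getD q v ∉ Fs) ∧ z = P.support.getD r v}

/-- `y` is distant from `x` (both `K`-major), for a tidy near-prism. -/
def Distant (G : SimpleGraph V) (ℓ : ℕ) {a b : Fin 3 → V}
    (P : ∀ i : Fin 3, G.Walk (a i) (b i)) (x y : V) : Prop :=
  ¬ G.Adj x y ∧
  (∃ z ∈ A123 G P x, G.Adj y z) ∧
  (∀ i, (∃ z ∈ (P i).support, G.Adj x z) →
    ∀ z ∈ Kmn G (frameStar ℓ P) (P i) (alpha G (P i) x) (ℓ - 2) 1, ¬ G.Adj y z) ∧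
  (∀ i, (¬ ∃ z ∈ (P i).support, G.Adj x z) →
    ∃ j, j ≠ i ∧
      ∀ z ∈ Kmn G (frameStar ℓ P) (P j) (beta G (P j) x) 0 (ℓ - 3), ¬ G.Adj y z)

/-- The hole `c`, regarded as a graph on `V`. -/
def holeGraph (G : SimpleGraph V) {u : V} (c : G.Walk u u) : SimpleGraph V :=
  SimpleGraph.fromEdgeSet {e | e ∈ c.edges}

/-- The distance between two vertices in the hole `c`. -/
noncomputable def holeDist (G : SimpleGraph V) {u : V} (c : G.Walk u u) (x y : V) : ℕ :=
  (holeGraph G c).dist x y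

/-- `x` is `C`-major for the hole `c`: `x` is not on `c` and no path of `c` with at most
three vertices contains all neighbours of `x` on `c`. -/
def CMajor (G : SimpleGraph V) {u : V} (c : G.Walk u u) (x : V) : Prop :=
  x ∉ c.support ∧
  ¬ ∃ q ∈ c.support, ∀ z ∈ c.support, G.Adj x z → z = q ∨ s(q, z) ∈ c.edges

/-- A shortest long even hole. -/
def ShortestLEH (G : SimpleGraph V) (ℓ : ℕ) {u : V} (c : G.Walk u u) : Prop :=
  IsLongEvenHole ℓ c ∧
  ∀ (v : V) (c' : G.Walk v v), IsLongEvenHole ℓ c' → c.length ≤ c'.length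

/-- `L₁, L₂` are the two `x y`-paths of the hole `c`. -/
def ArcPair {G : SimpleGraph V} {u : V} (c : G.Walk u u) {x y : V}
    (L₁ L₂ : G.Walk x y) : Prop :=
  L₁.IsPath ∧ L₂.IsPath ∧
  (∀ e ∈ L₁.edges, e ∈ c.edges) ∧ (∀ e ∈ L₂.edges, e ∈ c.edges) ∧
  (∀ e ∈ c.edges, e ∈ L₁.edges ∨ e ∈ L₂.edges) ∧
  (∀ e ∈ L₁.edges, e ∉ L₂.edges)

/-- `X` is lighter than `Y`, with respect to the linear order on edges given by `idx`. -/
def Lighter [DecidableEq V] (idx : Sym2 V → ℕ) (X Y : Finset (Sym2 V)) : Prop :=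
  X.card < Y.card ∨
  (X.card = Y.card ∧ ∃ e ∈ Y, e ∉ X ∧
    ∀ f : Sym2 V, ((f ∈ X ∧ f ∉ Y) ∨ (f ∈ Y ∧ f ∉ X)) → idx e ≤ idx f)

/-- The lightest long even hole. -/
def LightestLEH [DecidableEq V] (G : SimpleGraph V) (ℓ : ℕ) (idx : Sym2 V → ℕ)
    {u : V} (c : G.Walk u u) : Prop :=
  IsLongEvenHole ℓ c ∧
  ∀ (v : V) (c' : G.Walk v v), IsLongEvenHole ℓ c' →
    c'.edges.toFinset ≠ c.edges.toFinset →
    Lighter idx c.edges.toFinset c'.edges.toFinset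

/-- A `(C,x)`-gap: a path of the hole `c` of length at least two whose ends are adjacent
to `x` and none of whose interior vertices is adjacent to `x`. -/
def IsGap (G : SimpleGraph V) {u : V} (c : G.Walk u u) (x : V) {p₁ p₂ : V}
    (P : G.Walk p₁ p₂) : Prop :=
  P.IsPath ∧ (∀ e ∈ P.edges, e ∈ c.edges) ∧ 2 ≤ P.length ∧
  G.Adj x p₁ ∧ G.Adj x p₂ ∧ ∀ z ∈ inter P, ¬ G.Adj x z

end LEH

namespace LEH

variable {V : Type*}

/-- There is an induced path from `u` to `v` with vertex set `S` and length `n`. -/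
def IPath (G : SimpleGraph V) (u v : V) (S : Set V) (n : ℕ) : Prop :=
  ∃ W : G.Walk u v, IsInducedPath W ∧ vset W = S ∧ W.length = n

/-- `S` and `T` are disjoint and every edge between them satisfies `E`. -/
def Only (G : SimpleGraph V) (S T : Set V) (E : V → V → Prop) : Prop :=
  ∀ s ∈ S, ∀ t ∈ T, s ≠ t ∧ (G.Adj s t → E s t)

variable {G : SimpleGraph V}

lemma IPath.single (u : V) : IPath G u u {u} 0 :=
  ⟨Walk.nil, ⟨by simp, by simp +contextual⟩, by ext; simp [vset], rfl⟩

lemma IPath.reverse {u v : V} {S : Set V} {n : ℕ} (h : IPath G u v S n) :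
    IPath G v u S n := by
  obtain ⟨W, ⟨hp, hi⟩, rfl, rfl⟩ := h
  refine ⟨W.reverse, ⟨hp.reverse, fun x hx y hy hxy => ?_⟩, by ext; simp [vset], by simp⟩
  simpa using hi x (by simpa using hx) y (by simpa using hy) hxy

lemma IPath.join {u v w t : V} {S T : Set V} {m n : ℕ} (h₁ : IPath G u v S m)
    (h₂ : IPath G w t T n) (hvw : G.Adj v w)
    (hST : Only G S T fun a b => a = v ∧ b = w) : IPath G u t (S ∪ T) (m + n + 1) := by
  obtain ⟨W, ⟨hp, hi⟩, rfl, rfl⟩ := h₁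
  obtain ⟨W', ⟨hp', hi'⟩, rfl, rfl⟩ := h₂
  refine ⟨W.append (Walk.cons hvw W'), ⟨?_, ?_⟩, ?_, ?_⟩
  · rw [Walk.isPath_def, Walk.support_append, Walk.support_cons, List.tail_cons,
      List.nodup_append]
    exact ⟨hp.support_nodup, hp'.support_nodup, fun a ha b hb => (hST a ha b hb).1⟩
  · intro x hx y hy hxy
    rw [Walk.mem_support_append_iff, Walk.support_cons, List.mem_cons] at hx hy
    rw [Walk.edges_append, Walk.edges_cons, List.mem_append, List.mem_cons]
    have key : ∀ a ∈ W.support, ∀ b ∈ W'.support, G.Adj a b → s(a, b) = s(v, w) := by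
      intro a ha b hb hab
      obtain ⟨rfl, rfl⟩ := (hST a ha b hb).2 hab
      rfl
    have hx' : x ∈ W.support ∨ x ∈ W'.support := by
      rcases hx with h | rfl | h
      exacts [Or.inl h, Or.inl W.end_mem_support, Or.inr h]
    have hy' : y ∈ W.support ∨ y ∈ W'.support := by
      rcases hy with h | rfl | h
      exacts [Or.inl h, Or.inl W.end_mem_support, Or.inr h]
    rcases hx' with hx' | hx' <;> rcases hy' with hy' | hy'
    · exact Or.inl (hi x hx' y hy' hxy)
    · exact Or.inr (Or.inl (key x hx' y hy' hxy))
    · exact Or.inr (Or.inl (by rw [Sym2.eq_swap]; exact key y hy' x hx' hxy.symm))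
    · exact Or.inr (Or.inr (hi' x hx' y hy' hxy))
  · ext x
    simp only [vset, Walk.mem_support_append_iff, Walk.support_cons, List.mem_cons,
      Set.mem_ofPred_eq, Set.mem_union]
    constructor
    · rintro (h | rfl | h)
      exacts [Or.inl h, Or.inl W.end_mem_support, Or.inr h]
    · rintro (h | h)
      exacts [Or.inl h, Or.inr (Or.inr h)]
  · simp [Walk.length_append]; omega

/-- A leg of a theta with ends `u`, `v`: a path with interior `S` of length `n`. -/
structure Leg (G : SimpleGraph V) (u v : V) (S : Set V) (n : ℕ) : Prop where
  path : ∃ s t, IPath G s t S n ∧ G.Adj u s ∧ G.Adj v t ∧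
    Only G {u} S (fun _ b => b = s) ∧ Only G {v} S (fun _ b => b = t)

lemma Leg.walk {u v : V} {S : Set V} {n : ℕ} (h : Leg G u v S n) (huv : u ≠ v)
    (hn : ¬ G.Adj u v) :
    ∃ W : G.Walk u v, IsInducedPath W ∧ inter W = S ∧ W.length = n + 2 := by
  obtain ⟨s, t, hp, hus, hvt, hu, hv⟩ := h.path
  have h1 := (IPath.single (G := G) u).join hp hus (fun a ha b hb => by
    have := hu a ha b hb
    exact ⟨this.1, fun h => ⟨ha, this.2 h⟩⟩)
  have h2 := h1.join (IPath.single (G := G) v) hvt.symm (fun a ha b hb => by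
    rcases ha with rfl | ha
    · rw [Set.mem_singleton_iff] at hb
      subst hb
      exact ⟨huv, fun h => (hn h).elim⟩
    · have := hv b hb a ha
      exact ⟨this.1.symm, fun h => ⟨this.2 h.symm, hb⟩⟩)
  obtain ⟨W, hW, hS, hl⟩ := h2
  refine ⟨W, hW, ?_, by omega⟩
  have : inter W = vset W \ {u, v} := by
    ext x; simp [inter, vset]
  rw [this, hS]
  ext x
  have hxu : x ∈ S → x ≠ u := fun h => (hu u rfl x h).1.symm
  have hxv : x ∈ S → x ≠ v := fun h => (hv v rfl x h).1.symm
  simp only [Set.mem_sdiff, Set.mem_union, Set.mem_singleton_iff, Set.mem_insert_iff]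
  tauto

lemma hasLongTheta_of_legs {ℓ : ℕ} {u v : V} {S₁ S₂ S₃ : Set V} {n₁ n₂ n₃ : ℕ}
    (huv : u ≠ v) (hn : ¬ G.Adj u v) (h₁ : Leg G u v S₁ n₁) (h₂ : Leg G u v S₂ n₂)
    (h₃ : Leg G u v S₃ n₃) (h12 : Anticomplete G S₁ S₂) (h13 : Anticomplete G S₁ S₃)
    (h23 : Anticomplete G S₂ S₃) (l12 : ℓ ≤ n₁ + n₂ + 4) (l13 : ℓ ≤ n₁ + n₃ + 4)
    (l23 : ℓ ≤ n₂ + n₃ + 4) : HasLongTheta G ℓ := by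
  obtain ⟨W₁, i₁, rfl, k₁⟩ := h₁.walk huv hn
  obtain ⟨W₂, i₂, rfl, k₂⟩ := h₂.walk huv hn
  obtain ⟨W₃, i₃, rfl, k₃⟩ := h₃.walk huv hn
  exact ⟨u, v, W₁, W₂, W₃, huv, hn, i₁, i₂, i₃, h12, h13, h23, by omega, by omega, by omega⟩

lemma isLongHoleOn_of_paths {ℓ : ℕ} (hℓ : 4 ≤ ℓ) {a b a' b' : V} {W : G.Walk a b}
    {W' : G.Walk a' b'} (hW : IsInducedPath W) (hW' : IsInducedPath W')
    (ha : G.Adj a a') (hb : G.Adj b b')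
    (ho : Only G (vset W) (vset W') fun s t => s = a ∧ t = a' ∨ s = b ∧ t = b')
    (hl : ℓ ≤ W.length + W'.length + 2) : IsLongHoleOn G ℓ (vset W ∪ vset W') := by
  have hd : ∀ s ∈ W.support, ∀ t ∈ W'.support, s ≠ t := fun s hs t ht => (ho s hs t ht).1
  set Q : G.Walk a a' := W.append (Walk.cons hb W'.reverse) with hQ
  have hQs : ∀ x, x ∈ Q.support ↔ x ∈ W.support ∨ x ∈ W'.support := by
    intro x
    simp only [hQ, Walk.mem_support_append_iff, Walk.support_cons, List.mem_cons,
      Walk.support_reverse, List.mem_reverse]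
    constructor
    · rintro (h | rfl | h)
      exacts [Or.inl h, Or.inl W.end_mem_support, Or.inr h]
    · tauto
  have hQp : Q.IsPath := by
    rw [Walk.isPath_def, hQ, Walk.support_append, Walk.support_cons, List.tail_cons,
      List.nodup_append]
    refine ⟨hW.1.support_nodup, hW'.1.reverse.support_nodup, fun s hs t ht => ?_⟩
    exact hd s hs t (by simpa using ht)
  have hQe : ∀ e, e ∈ Q.edges ↔ e ∈ W.edges ∨ e = s(b, b') ∨ e ∈ W'.edges := by
    intro e
    simp [hQ, Walk.edges_append]
  have hne : s(a', a) ∉ Q.edges := by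
    rw [hQe]
    rintro (h | h | h)
    · exact hd _ (W.fst_mem_support_of_mem_edges h) _ W'.start_mem_support rfl
    · rw [Sym2.eq_iff] at h
      rcases h with ⟨h1, h2⟩ | ⟨h1, h2⟩
      · exact hd _ W.end_mem_support _ W'.start_mem_support h1.symm
      · subst h1 h2
        have := Walk.length_eq_zero_iff.2 (Walk.isPath_iff_nil.1 hW.1)
        have := Walk.length_eq_zero_iff.2 (Walk.isPath_iff_nil.1 hW'.1)
        omega
    · exact hd _ W.start_mem_support _ (W'.snd_mem_support_of_mem_edges h) rfl
  have hlen : Q.length = W.length + W'.length + 1 := by simp [hQ, Walk.length_append]; omega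
  refine ⟨a', Walk.cons ha.symm Q, ⟨?_, ?_, ?_⟩, ?_, ?_⟩
  · exact (Walk.cons_isCycle_iff _ _).2 ⟨hQp, hne⟩
  · simp [hlen]; omega
  · have key : ∀ s ∈ W.support, ∀ t ∈ W'.support, G.Adj s t →
        s(s, t) ∈ (Walk.cons ha.symm Q).edges := by
      intro s hs t ht hst
      rw [Walk.edges_cons, List.mem_cons, hQe]
      rcases (ho s hs t ht).2 hst with ⟨rfl, rfl⟩ | ⟨rfl, rfl⟩
      · exact Or.inl Sym2.eq_swap
      · exact Or.inr (Or.inr (Or.inl rfl))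
    have hs : ∀ x, x ∈ (Walk.cons ha.symm Q).support → x ∈ W.support ∨ x ∈ W'.support := by
      intro x hx
      rw [Walk.support_cons, List.mem_cons] at hx
      rcases hx with rfl | hx
      exacts [Or.inr W'.start_mem_support, (hQs x).1 hx]
    intro x hx y hy hxy
    rcases hs x hx with hx' | hx' <;> rcases hs y hy with hy' | hy'
    · rw [Walk.edges_cons, List.mem_cons, hQe]
      exact Or.inr (Or.inl (hW.2 x hx' y hy' hxy))
    · exact key x hx' y hy' hxy
    · rw [Sym2.eq_swap]; exact key y hy' x hx' hxy.symm
    · rw [Walk.edges_cons, List.mem_cons, hQe]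
      exact Or.inr (Or.inr (Or.inr (hW'.2 x hx' y hy' hxy)))
  · simp [hlen]; omega
  · ext x
    simp only [Walk.support_cons, List.mem_cons, Set.mem_ofPred_eq, hQs, vset, Set.mem_union]
    constructor
    · rintro (rfl | h)
      exacts [Or.inr W'.start_mem_support, h]
    · exact Or.inr

/-- No long near-prism of `G` has fewer than `N` vertices. -/
def NoSmallerLNP (G : SimpleGraph V) (ℓ N : ℕ) : Prop :=
  ∀ (a b : Fin 3 → V) (P : ∀ i : Fin 3, G.Walk (a i) (b i)),
    IsLongNearPrism ℓ a b P → N ≤ (prismSupport P).ncard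

lemma NoSmallerLNP.elim [Finite V] {ℓ N : ℕ} (hmin : NoSmallerLNP G ℓ N) (hℓ : 6 ≤ ℓ)
    {a₁ a₂ a₃ b₁ b₂ b₃ : V} {S₁ S₂ S₃ : Set V} {n₁ n₂ n₃ : ℕ}
    (h₁ : IPath G a₁ b₁ S₁ n₁) (h₂ : IPath G a₂ b₂ S₂ n₂) (h₃ : IPath G a₃ b₃ S₃ n₃)
    (ha12 : G.Adj a₁ a₂) (ha13 : G.Adj a₁ a₃) (ha23 : G.Adj a₂ a₃)
    (hb12 : G.Adj b₁ b₂) (hb13 : G.Adj b₁ b₃) (hb23 : G.Adj b₂ b₃)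
    (o12 : Only G S₁ S₂ fun s t => s = a₁ ∧ t = a₂ ∨ s = b₁ ∧ t = b₂)
    (o13 : Only G S₁ S₃ fun s t => s = a₁ ∧ t = a₃ ∨ s = b₁ ∧ t = b₃)
    (o23 : Only G S₂ S₃ fun s t => s = a₂ ∧ t = a₃ ∨ s = b₂ ∧ t = b₃)
    (l12 : ℓ ≤ n₁ + n₂ + 2) (l13 : ℓ ≤ n₁ + n₃ + 2) (l23 : ℓ ≤ n₂ + n₃ + 2)
    (hN : n₁ + n₂ + n₃ + 3 < N) : False := by
  obtain ⟨W₁, i₁, rfl, rfl⟩ := h₁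
  obtain ⟨W₂, i₂, rfl, rfl⟩ := h₂
  obtain ⟨W₃, i₃, rfl, rfl⟩ := h₃
  let P : ∀ i : Fin 3, G.Walk (![a₁, a₂, a₃] i) (![b₁, b₂, b₃] i) := fun i =>
    match i with
    | 0 => W₁
    | 1 => W₂
    | 2 => W₃
  have H12 := isLongHoleOn_of_paths (by omega) i₁ i₂ ha12 hb12 o12 l12
  have H13 := isLongHoleOn_of_paths (by omega) i₁ i₃ ha13 hb13 o13 l13
  have H23 := isLongHoleOn_of_paths (by omega) i₂ i₃ ha23 hb23 o23 l23
  have hd : ∀ i j, i ≠ j → ∀ x, x ∈ (P i).support → x ∉ (P j).support := by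
    intro i j hij x hx hx'
    fin_cases i <;> fin_cases j <;> first | exact hij rfl | skip
    · exact (o12 x hx x hx').1 rfl
    · exact (o13 x hx x hx').1 rfl
    · exact (o12 x hx' x hx).1 rfl
    · exact (o23 x hx x hx').1 rfl
    · exact (o13 x hx' x hx).1 rfl
    · exact (o23 x hx' x hx).1 rfl
  have hp : ∀ i, (P i).IsPath := by
    intro i
    fin_cases i
    exacts [i₁.1, i₂.1, i₃.1]
  have hlen : ∀ i j, i ≠ j → ℓ ≤ (P i).length + (P j).length + 2 := by
    intro i j hij
    fin_cases i <;> fin_cases j <;> first | exact (hij rfl).elim | skip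
    · exact l12
    · exact l13
    · change ℓ ≤ W₂.length + W₁.length + 2; omega
    · exact l23
    · change ℓ ≤ W₃.length + W₁.length + 2; omega
    · change ℓ ≤ W₃.length + W₂.length + 2; omega
  have hK : IsLongNearPrism ℓ ![a₁, a₂, a₃] ![b₁, b₂, b₃] P := by
    refine ⟨?_, ?_, ?_, hp, hd, ?_⟩
    · intro i j hij
      fin_cases i <;> fin_cases j <;> first | exact (hij rfl).elim | simp_all [G.adj_comm]
    · intro i j hij
      fin_cases i <;> fin_cases j <;> first | exact (hij rfl).elim | simp_all [G.adj_comm]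
    · have key : ∀ i j, ![a₁, a₂, a₃] i = ![b₁, b₂, b₃] j → i = j ∧ (P i).length = 0 := by
        intro i j h
        by_cases hij : i = j
        · subst hij
          refine ⟨rfl, ?_⟩
          have := hp i
          revert this
          generalize P i = W
          revert W
          rw [h]
          intro W hW
          exact Walk.length_eq_zero_iff.2 (Walk.isPath_iff_nil.1 hW)
        · have hv : ∀ v, ![a₁, a₂, a₃] i = v → v ∉ (P j).support := by
            rintro _ rfl
            exact hd i j hij _ (P i).start_mem_support
          exact (hv _ h (P j).end_mem_support).elim
      rintro _ ⟨⟨i, rfl⟩, ⟨j, hj⟩⟩ _ ⟨⟨i', rfl⟩, ⟨j', hj'⟩⟩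
      by_cases h : i = i'
      · rw [h]
      · have := key i j hj.symm
        have := key i' j' hj'.symm
        have := hlen i i' h
        omega
    · intro i j hij
      fin_cases i <;> fin_cases j <;> first | exact (hij rfl).elim | skip
      · exact H12
      · exact H13
      · rw [Set.union_comm]; exact H12
      · exact H23
      · rw [Set.union_comm]; exact H13
      · rw [Set.union_comm]; exact H23
  have hc := hmin _ _ P hK
  have hcard : ∀ {u v : V} (W : G.Walk u v), (vset W).ncard ≤ W.length + 1 := by
    classical
    intro u v W
    have : vset W = (W.support.toFinset : Set V) := by ext; simp [vset]
    rw [this, Set.ncard_coe_finset, ← Walk.length_support]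
    exact List.toFinset_card_le _
  have hU : prismSupport P = vset W₁ ∪ vset W₂ ∪ vset W₃ := by
    ext v
    simp only [prismSupport, Set.mem_iUnion, Set.mem_union]
    constructor
    · rintro ⟨i, hi⟩
      fin_cases i
      exacts [Or.inl (Or.inl hi), Or.inl (Or.inr hi), Or.inr hi]
    · rintro ((h | h) | h)
      exacts [⟨0, h⟩, ⟨1, h⟩, ⟨2, h⟩]
  rw [hU] at hc
  have c1 := Set.ncard_union_le (vset W₁ ∪ vset W₂) (vset W₃)
  have c2 := Set.ncard_union_le (vset W₁) (vset W₂)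
  have := hcard W₁
  have := hcard W₂
  have := hcard W₃
  omega

/-- Coordinates for three disjoint paths `m ↦ p i m`, `m ≤ L i`, whose only mutual edges join
their first vertices and their last vertices. -/
structure Model (G : SimpleGraph V) (p : Fin 3 → ℕ → V) (L : Fin 3 → ℕ) : Prop where
  adj_same : ∀ i m n, m ≤ L i → n ≤ L i → (G.Adj (p i m) (p i n) ↔ m + 1 = n ∨ n + 1 = m)
  adj_diff : ∀ i j, i ≠ j → ∀ m n, m ≤ L i → n ≤ L j →
    (G.Adj (p i m) (p j n) ↔ m = 0 ∧ n = 0 ∨ m = L i ∧ n = L j)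
  eq_same : ∀ i m n, m ≤ L i → n ≤ L i → (p i m = p i n ↔ m = n)
  ne_diff : ∀ i j, i ≠ j → ∀ m n, m ≤ L i → n ≤ L j → p i m ≠ p j n

/-- A vertex off the three paths whose neighbours on them avoid the frame. -/
structure Outer (G : SimpleGraph V) (p : Fin 3 → ℕ → V) (L : Fin 3 → ℕ) (h : ℕ) (q : V) :
    Prop where
  ne : ∀ i m, m ≤ L i → q ≠ p i m
  frame : ∀ i m, G.Adj q (p i m) → h ≤ m ∧ m + h ≤ L i ∧ 2 * h + 2 ≤ L i

/-- The vertices `p i k` with `m ≤ k ≤ n`. -/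
def seg (p : Fin 3 → ℕ → V) (i : Fin 3) (m n : ℕ) : Set V :=
  {v | ∃ k, m ≤ k ∧ k ≤ n ∧ v = p i k}

lemma mem_seg {p : Fin 3 → ℕ → V} {i : Fin 3} {m n : ℕ} {v : V} :
    v ∈ seg p i m n ↔ ∃ k, m ≤ k ∧ k ≤ n ∧ v = p i k := Iff.rfl

variable {p : Fin 3 → ℕ → V} {L : Fin 3 → ℕ} {h : ℕ}

lemma Model.ipath_up (M : Model G p L) (i : Fin 3) {m n : ℕ} (hmn : m ≤ n) (hn : n ≤ L i) :
    IPath G (p i m) (p i n) (seg p i m n) (n - m) := by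
  induction n, hmn using Nat.le_induction with
  | base =>
    have : seg p i m m = {p i m} := by
      ext v
      simp only [mem_seg, Set.mem_singleton_iff]
      exact ⟨fun ⟨k, h1, h2, h3⟩ => by rw [h3, le_antisymm h2 h1],
        fun h => ⟨m, le_rfl, le_rfl, h⟩⟩
    rw [this, Nat.sub_self]
    exact IPath.single _
  | succ n hmn ih =>
    have hs : seg p i m (n + 1) = seg p i m n ∪ {p i (n + 1)} := by
      ext v
      simp only [mem_seg, Set.mem_union, Set.mem_singleton_iff]
      constructor
      · rintro ⟨k, h1, h2, h3⟩
        rcases Nat.lt_or_ge n k with h4 | h4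
        · exact Or.inr (by rw [h3, le_antisymm h2 h4])
        · exact Or.inl ⟨k, h1, h4, h3⟩
      · rintro (⟨k, h1, h2, h3⟩ | h3)
        exacts [⟨k, h1, by omega, h3⟩, ⟨n + 1, by omega, le_rfl, h3⟩]
    have := (ih (by omega)).join (IPath.single (p i (n + 1)))
      ((M.adj_same i n (n + 1) (by omega) hn).2 (Or.inl rfl)) (by
        rintro _ ⟨k, h1, h2, rfl⟩ _ rfl
        rw [Ne, M.eq_same i _ _ (by omega) hn, M.adj_same i _ _ (by omega) hn]
        refine ⟨by omega, fun h => ⟨?_, rfl⟩⟩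
        rw [show k = n by omega])
    rw [hs, show n + 1 - m = n - m + 0 + 1 by omega]
    exact this

lemma Model.ipath_down (M : Model G p L) (i : Fin 3) {m n : ℕ} (hmn : m ≤ n) (hn : n ≤ L i) :
    IPath G (p i n) (p i m) (seg p i m n) (n - m) :=
  (M.ipath_up i hmn hn).reverse

lemma exists_first {q : V} {i : Fin 3} (hq : ∃ m, G.Adj q (p i m)) :
    ∃ m, G.Adj q (p i m) ∧ ∀ n, G.Adj q (p i n) → m ≤ n := by
  classical
  exact ⟨Nat.find hq, Nat.find_spec hq, fun n hn => Nat.find_min' hq hn⟩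

lemma exists_last_le {q : V} {i : Fin 3} {N : ℕ} (hq : ∃ m ≤ N, G.Adj q (p i m)) :
    ∃ m ≤ N, G.Adj q (p i m) ∧ ∀ n ≤ N, G.Adj q (p i n) → n ≤ m := by
  classical
  obtain ⟨m, hm, ha⟩ := hq
  exact ⟨Nat.findGreatest (fun m => G.Adj q (p i m)) N, Nat.findGreatest_le N,
    Nat.findGreatest_spec (P := fun m => G.Adj q (p i m)) hm ha,
    fun n hn hna => Nat.le_findGreatest hn hna⟩

lemma Outer.exists_last {q : V} (hq : Outer G p L h q) {i : Fin 3} (ha : ∃ m, G.Adj q (p i m)) :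
    ∃ m, G.Adj q (p i m) ∧ ∀ n, G.Adj q (p i n) → n ≤ m := by
  obtain ⟨m, -, hm, hl⟩ := exists_last_le (N := L i)
    (ha.imp fun m hm => ⟨by have := hq.frame i m hm; omega, hm⟩)
  exact ⟨m, hm, fun n hn => hl n (by have := hq.frame i n hn; omega) hn⟩

lemma Only.union_left {S S' T : Set V} {E : V → V → Prop} (h₁ : Only G S T E)
    (h₂ : Only G S' T E) : Only G (S ∪ S') T E := fun s hs =>
  hs.elim (h₁ s) (h₂ s)

lemma Only.union_right {S T T' : Set V} {E : V → V → Prop} (h₁ : Only G S T E)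
    (h₂ : Only G S T' E) : Only G S (T ∪ T') E := fun s hs t ht =>
  ht.elim (h₁ s hs t) (h₂ s hs t)

lemma Only.anticomplete {S T : Set V} (h : Only G S T fun _ _ => False) :
    Anticomplete G S T := fun s hs t ht => h s hs t ht

lemma only_single_single {q r : V} {E : V → V → Prop} (hne : q ≠ r) (hE : G.Adj q r → E q r) :
    Only G {q} {r} E := by
  rintro _ rfl _ rfl
  exact ⟨hne, hE⟩

lemma Model.only_diff (M : Model G p L) {i j : Fin 3} (hij : i ≠ j) {m n m' n' : ℕ}
    {E : V → V → Prop} (hn : n ≤ L i) (hn' : n' ≤ L j)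
    (h0 : m = 0 → m' = 0 → E (p i 0) (p j 0))
    (hL : n = L i → n' = L j → E (p i (L i)) (p j (L j))) :
    Only G (seg p i m n) (seg p j m' n') E := by
  rintro _ ⟨k, h1, h2, rfl⟩ _ ⟨k', h1', h2', rfl⟩
  refine ⟨M.ne_diff i j hij k k' (by omega) (by omega), fun ha => ?_⟩
  rcases (M.adj_diff i j hij k k' (by omega) (by omega)).1 ha with ⟨rfl, rfl⟩ | ⟨rfl, rfl⟩
  · exact h0 (by omega) (by omega)
  · exact hL (by omega) (by omega)

lemma Model.only_lt (M : Model G p L) {i : Fin 3} {m n m' n' : ℕ} {E : V → V → Prop}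
    (hlt : n < m') (hn' : n' ≤ L i) (hE : n + 1 = m' → E (p i n) (p i m')) :
    Only G (seg p i m n) (seg p i m' n') E := by
  rintro _ ⟨k, h1, h2, rfl⟩ _ ⟨k', h1', h2', rfl⟩
  rw [Ne, M.eq_same i _ _ (by omega) (by omega), M.adj_same i _ _ (by omega) (by omega)]
  refine ⟨by omega, fun ha => ?_⟩
  rw [show k = n by omega, show k' = m' by omega]
  exact hE (by omega)

lemma Model.only_gt (M : Model G p L) {i : Fin 3} {m n m' n' : ℕ} {E : V → V → Prop}
    (hlt : n' < m) (hn : n ≤ L i) (hE : n' + 1 = m → E (p i m) (p i n')) :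
    Only G (seg p i m n) (seg p i m' n') E := fun s hs t ht => by
  have := M.only_lt (m := m') (E := fun a b => E b a) hlt hn hE t ht s hs
  exact ⟨this.1.symm, fun ha => this.2 ha.symm⟩

lemma Model.only_single_lt (M : Model G p L) {i : Fin 3} {c m n : ℕ} {E : V → V → Prop}
    (hlt : c < m) (hn : n ≤ L i) (hE : c + 1 = m → E (p i c) (p i m)) :
    Only G {p i c} (seg p i m n) E := by
  have := M.only_lt (m := c) hlt hn hE
  rintro _ rfl
  exact this _ ⟨c, le_rfl, le_rfl, rfl⟩

lemma Model.only_single_gt (M : Model G p L) {i : Fin 3} {c m n : ℕ} {E : V → V → Prop}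
    (hlt : n < c) (hc : c ≤ L i) (hE : n + 1 = c → E (p i c) (p i n)) :
    Only G {p i c} (seg p i m n) E := by
  have := M.only_gt (n := c) (m' := m) hlt hc hE
  rintro _ rfl
  exact this _ ⟨c, le_rfl, le_rfl, rfl⟩

lemma Model.only_single_diff (M : Model G p L) {i j : Fin 3} (hij : i ≠ j) {c m n : ℕ}
    {E : V → V → Prop} (hc : 0 < c) (hc' : c < L i) (hn : n ≤ L j) :
    Only G {p i c} (seg p j m n) E := by
  have := M.only_diff (E := E) hij (m := c) (m' := m) hc'.le hn (by omega) (by omega)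
  rintro _ rfl
  exact this _ ⟨c, le_rfl, le_rfl, rfl⟩

lemma Outer.only_seg {q : V} (hq : Outer G p L h q) {i : Fin 3} {m n : ℕ} {E : V → V → Prop}
    (hn : n ≤ L i) (hE : ∀ k, G.Adj q (p i k) → m ≤ k → k ≤ n → E q (p i k)) :
    Only G {q} (seg p i m n) E := by
  rintro _ rfl _ ⟨k, h1, h2, rfl⟩
  exact ⟨hq.ne i k (by omega), fun ha => hE k ha h1 h2⟩

lemma Outer.seg_only {q : V} (hq : Outer G p L h q) {i : Fin 3} {m n : ℕ} {E : V → V → Prop}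
    (hn : n ≤ L i) (hE : ∀ k, G.Adj q (p i k) → m ≤ k → k ≤ n → E (p i k) q) :
    Only G (seg p i m n) {q} E := by
  rintro _ ⟨k, h1, h2, rfl⟩ _ rfl
  exact ⟨(hq.ne i k (by omega)).symm, fun ha => hE k ha.symm h1 h2⟩

lemma false_of_one_hit [Finite V] (M : Model G p L) (hh : 2 ≤ h) {i j k : Fin 3}
    (hij : i ≠ j) (hik : i ≠ k) (hjk : j ≠ k)
    (hmin : NoSmallerLNP G (2 * h + 2) (L i + L j + L k + 3))
    (hlong : 2 * h + 2 ≤ L i ∨ 2 * h + 2 ≤ L j) {q : V} (hq : Outer G p L h q)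
    (hi : ∀ m, ¬ G.Adj q (p i m)) (hj : ∀ m, ¬ G.Adj q (p j m)) {α β : ℕ}
    (hα : G.Adj q (p k α)) (hβ : G.Adj q (p k β)) (hα' : ∀ n, G.Adj q (p k n) → α ≤ n)
    (hβ' : ∀ n, G.Adj q (p k n) → n ≤ β) (hαβ : α + 3 ≤ β) : False := by
  have fα := hq.frame k α hα
  have fβ := hq.frame k β hβ
  have e1 := M.ipath_up i (Nat.zero_le (L i)) le_rfl
  have e2 := M.ipath_up j (Nat.zero_le (L j)) le_rfl
  have e3 := ((M.ipath_up k (Nat.zero_le α) (by omega)).join (.single q) hα.symm (by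
    repeat' first
      | omega
      | assumption
      | apply Only.union_left
      | apply Only.union_right
      | refine M.only_diff (by assumption) ?_ ?_ ?_ ?_
      | refine M.only_lt (by omega) ?_ ?_
      | refine M.only_gt (by omega) ?_ ?_
      | refine Outer.only_seg (by assumption) ?_ ?_
      | refine Outer.seg_only (by assumption) ?_ ?_
      | grind)).join (M.ipath_up k (show β ≤ L k by omega) le_rfl) hβ (by
    repeat' first
      | omega
      | assumption
      | apply Only.union_left
      | apply Only.union_right
      | refine M.only_diff (by assumption) ?_ ?_ ?_ ?_
      | refine M.only_lt (by omega) ?_ ?_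
      | refine M.only_gt (by omega) ?_ ?_
      | refine Outer.only_seg (by assumption) ?_ ?_
      | refine Outer.seg_only (by assumption) ?_ ?_
      | grind)
  refine hmin.elim (by omega) e1 e2 e3 ?_ ?_ ?_ ?_ ?_ ?_ ?_ ?_ ?_ ?_ ?_ ?_ ?_
  repeat' first
    | omega
    | assumption
    | apply Only.union_left
    | apply Only.union_right
    | refine M.only_diff (by assumption) ?_ ?_ ?_ ?_
    | refine M.only_lt (by omega) ?_ ?_
    | refine M.only_gt (by omega) ?_ ?_
    | refine M.adj_diff _ _ (by assumption) _ _ (by omega) (by omega) |>.2 (by omega)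
    | refine Outer.only_seg (by assumption) ?_ ?_
    | refine Outer.seg_only (by assumption) ?_ ?_
    | grind

/-- Between two vertices with neighbours on the same path there is a connecting subpath. -/
lemma exists_bridge (M : Model G p L) {q r : V} (hq : Outer G p L h q) (hr : Outer G p L h r)
    {j : Fin 3} (hqj : ∃ m, G.Adj q (p j m)) (hrj : ∃ m, G.Adj r (p j m)) :
    ∃ c d s t, IPath G s t (seg p j c d) (d - c) ∧ G.Adj q s ∧ G.Adj r t ∧ h ≤ c ∧
      c ≤ d ∧ d + h ≤ L j ∧ (∀ k, G.Adj q (p j k) → c ≤ k → k ≤ d → p j k = s) ∧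
      (∀ k, G.Adj r (p j k) → c ≤ k → k ≤ d → p j k = t) := by
  classical
  have hex : ∃ e m n, G.Adj q (p j m) ∧ G.Adj r (p j n) ∧ e = max m n - min m n := by
    obtain ⟨m, hm⟩ := hqj
    obtain ⟨n, hn⟩ := hrj
    exact ⟨_, m, n, hm, hn, rfl⟩
  obtain ⟨m, n, hm, hn, he⟩ := Nat.find_spec hex
  have hmin : ∀ m' n', G.Adj q (p j m') → G.Adj r (p j n') →
      max m n - min m n ≤ max m' n' - min m' n' := fun m' n' h1 h2 => by
    rw [← he]
    exact Nat.find_min' hex ⟨m', n', h1, h2, rfl⟩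
  have f1 := hq.frame j m hm
  have f2 := hr.frame j n hn
  rcases le_total m n with hmn | hmn
  · refine ⟨m, n, _, _, M.ipath_up j hmn (by omega), hm, hn, by omega, hmn, by omega, ?_, ?_⟩
    · intro k hk h1 h2
      have := hmin k n hk hn
      rw [show k = m by omega]
    · intro k hk h1 h2
      have := hmin m k hm hk
      rw [show k = n by omega]
  · refine ⟨n, m, _, _, M.ipath_down j hmn (by omega), hm, hn, by omega, hmn, by omega, ?_, ?_⟩
    · intro k hk h1 h2
      have := hmin k n hk hn
      rw [show k = m by omega]
    · intro k hk h1 h2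
      have := hmin m k hm hk
      rw [show k = n by omega]

/-- A vertex with no neighbour on one path does not have exactly two neighbours, these being
consecutive, on another one. -/
lemma false_of_consecutive [Finite V] (M : Model G p L) (hh : 2 ≤ h) {i j k : Fin 3}
    (hij : i ≠ j) (hik : i ≠ k) (hjk : j ≠ k)
    (hmin : NoSmallerLNP G (2 * h + 2) (L i + L j + L k + 3))
    {q : V} (hq : Outer G p L h q) (hk : ∀ m, ¬ G.Adj q (p k m)) {v α : ℕ}
    (hv : G.Adj q (p i v)) (hv' : G.Adj q (p i (v + 1)))
    (hvv : ∀ n, G.Adj q (p i n) → n = v ∨ n = v + 1)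
    (hα : G.Adj q (p j α)) (hα' : ∀ n, G.Adj q (p j n) → α ≤ n) : False := by
  have fα := hq.frame j α hα
  have fv := hq.frame i v hv
  have fv' := hq.frame i (v + 1) hv'
  have hji := hij.symm
  have hki := hik.symm
  have hkj := hjk.symm
  refine hmin.elim (by omega) (M.ipath_down i (Nat.zero_le v) (by omega))
    ((M.ipath_up i (show v + 1 ≤ L i by omega) le_rfl).join
      (M.ipath_down k (Nat.zero_le (L k)) le_rfl) ?_ ?_)
    ((IPath.single q).join (M.ipath_down j (Nat.zero_le α) (by omega)) hα ?_)
    ?_ ?_ ?_ ?_ ?_ ?_ ?_ ?_ ?_ ?_ ?_ ?_ ?_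
  repeat' first
    | omega
    | assumption
    | exact SimpleGraph.Adj.symm (by assumption)
    | exact SimpleGraph.Adj.ne (by assumption)
    | exact SimpleGraph.Adj.ne' (by assumption)
    | apply Only.union_left
    | apply Only.union_right
    | refine M.only_diff (by assumption) ?_ ?_ ?_ ?_
    | refine M.only_lt (by omega) ?_ ?_
    | refine M.only_gt (by omega) ?_ ?_
    | refine M.only_single_diff (by assumption) ?_ ?_ ?_
    | refine M.only_single_lt (by omega) ?_ ?_
    | refine M.only_single_gt (by omega) ?_ ?_
    | refine M.adj_diff _ _ (by assumption) _ _ (by omega) (by omega) |>.2 (by omega)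
    | refine M.adj_same _ _ _ (by omega) (by omega) |>.2 (by omega)
    | refine Outer.only_seg (by assumption) ?_ ?_
    | refine Outer.seg_only (by assumption) ?_ ?_
    | refine Only.anticomplete ?_
    | refine only_single_single ?_ ?_
    | grind [SimpleGraph.adj_comm]

/-- Three paths with pairwise anticomplete vertex sets whose ends attach to two nonadjacent
vertices form a theta. -/
lemma false_of_three_legs {ℓ : ℕ} (hnt : ¬ HasLongTheta G ℓ) {u v : V} (huv : u ≠ v)
    (hn : ¬ G.Adj u v) {s₁ s₂ s₃ t₁ t₂ t₃ : V} {S₁ S₂ S₃ : Set V} {n₁ n₂ n₃ : ℕ}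
    (h₁ : IPath G s₁ t₁ S₁ n₁) (h₂ : IPath G s₂ t₂ S₂ n₂) (h₃ : IPath G s₃ t₃ S₃ n₃)
    (hu₁ : G.Adj u s₁) (hu₂ : G.Adj u s₂) (hu₃ : G.Adj u s₃)
    (hv₁ : G.Adj v t₁) (hv₂ : G.Adj v t₂) (hv₃ : G.Adj v t₃)
    (ou₁ : Only G {u} S₁ fun _ b => b = s₁) (ou₂ : Only G {u} S₂ fun _ b => b = s₂)
    (ou₃ : Only G {u} S₃ fun _ b => b = s₃) (ov₁ : Only G {v} S₁ fun _ b => b = t₁)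
    (ov₂ : Only G {v} S₂ fun _ b => b = t₂) (ov₃ : Only G {v} S₃ fun _ b => b = t₃)
    (o12 : Only G S₁ S₂ fun _ _ => False) (o13 : Only G S₁ S₃ fun _ _ => False)
    (o23 : Only G S₂ S₃ fun _ _ => False) (l12 : ℓ ≤ n₁ + n₂ + 4) (l13 : ℓ ≤ n₁ + n₃ + 4)
    (l23 : ℓ ≤ n₂ + n₃ + 4) : False :=
  hnt (hasLongTheta_of_legs huv hn ⟨_, _, h₁, hu₁, hv₁, ou₁, ov₁⟩ ⟨_, _, h₂, hu₂, hv₂, ou₂, ov₂⟩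
    ⟨_, _, h₃, hu₃, hv₃, ou₃, ov₃⟩ o12.anticomplete o13.anticomplete o23.anticomplete
    l12 l13 l23)

lemma false_of_two_two (M : Model G p L) (hh : 2 ≤ h) (hnt : ¬ HasLongTheta G (2 * h + 2))
    {k k' j : Fin 3} (hkk' : k ≠ k') (hkj : k ≠ j) (hk'j : k' ≠ j) {y z : V}
    (hy : Outer G p L h y) (hz : Outer G p L h z) (hyz : y ≠ z) (hna : ¬ G.Adj y z)
    (hyk : ∀ m, ¬ G.Adj y (p k m)) (hzk : ∀ m, ¬ G.Adj z (p k' m))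
    (hyj : ∃ m, G.Adj y (p j m)) (hzj : ∃ m, G.Adj z (p j m)) {α β α' β' : ℕ}
    (hα : G.Adj y (p k' α)) (hβ : G.Adj y (p k' β)) (hα₁ : ∀ n, G.Adj y (p k' n) → α ≤ n)
    (hβ₁ : ∀ n, G.Adj y (p k' n) → n ≤ β) (hα' : G.Adj z (p k α')) (hβ' : G.Adj z (p k β'))
    (hα₁' : ∀ n, G.Adj z (p k n) → α' ≤ n) (hβ₁' : ∀ n, G.Adj z (p k n) → n ≤ β')
    (hαβ : α + 2 ≤ β) (hαβ' : α' + 2 ≤ β') : False := by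
  obtain ⟨c, d, s, t, hb, hys, hzt, hc, hcd, hd, hs, ht⟩ := exists_bridge M hy hz hyj hzj
  have f1 := hy.frame k' α hα
  have f2 := hy.frame k' β hβ
  have f3 := hz.frame k α' hα'
  have f4 := hz.frame k β' hβ'
  have hk'k := hkk'.symm
  have hjk := hkj.symm
  have hjk' := hk'j.symm
  refine false_of_three_legs hnt hyz hna
    ((M.ipath_down k' (Nat.zero_le α) (by omega)).join
      (M.ipath_up k (Nat.zero_le α') (by omega)) ?_ ?_)
    ((M.ipath_up k' (show β ≤ L k' by omega) le_rfl).join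
      (M.ipath_down k (show β' ≤ L k by omega) le_rfl) ?_ ?_) hb
    ?_ ?_ ?_ ?_ ?_ ?_ ?_ ?_ ?_ ?_ ?_ ?_ ?_ ?_ ?_ ?_ ?_ ?_
  repeat' first
    | omega
    | assumption
    | exact SimpleGraph.Adj.symm (by assumption)
    | exact SimpleGraph.Adj.ne (by assumption)
    | exact SimpleGraph.Adj.ne' (by assumption)
    | apply Only.union_left
    | apply Only.union_right
    | refine M.only_diff (by assumption) ?_ ?_ ?_ ?_
    | refine M.only_lt (by omega) ?_ ?_
    | refine M.only_gt (by omega) ?_ ?_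
    | refine M.only_single_diff (by assumption) ?_ ?_ ?_
    | refine M.only_single_lt (by omega) ?_ ?_
    | refine M.only_single_gt (by omega) ?_ ?_
    | refine M.adj_diff _ _ (by assumption) _ _ (by omega) (by omega) |>.2 (by omega)
    | refine M.adj_same _ _ _ (by omega) (by omega) |>.2 (by omega)
    | refine Outer.only_seg (by assumption) ?_ ?_
    | refine Outer.seg_only (by assumption) ?_ ?_
    | refine Only.anticomplete ?_
    | refine only_single_single ?_ ?_
    | grind [SimpleGraph.adj_comm]

lemma false_of_one_two (M : Model G p L) (hh : 2 ≤ h) (hnt : ¬ HasLongTheta G (2 * h + 2))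
    {k k' j : Fin 3} (hkk' : k ≠ k') (hkj : k ≠ j) (hk'j : k' ≠ j) {y z : V}
    (hy : Outer G p L h y) (hz : Outer G p L h z) (hyz : y ≠ z) (hna : ¬ G.Adj y z)
    (hyk : ∀ m, ¬ G.Adj y (p k m)) (hzk : ∀ m, ¬ G.Adj z (p k' m))
    (hyj : ∃ m, G.Adj y (p j m)) (hzj : ∃ m, G.Adj z (p j m)) {α α' β' : ℕ}
    (hα : G.Adj y (p k' α)) (hα₁ : ∀ n, G.Adj y (p k' n) → n = α)
    (hα' : G.Adj z (p k α')) (hβ' : G.Adj z (p k β'))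
    (hα₁' : ∀ n, G.Adj z (p k n) → α' ≤ n) (hβ₁' : ∀ n, G.Adj z (p k n) → n ≤ β')
    (hαβ' : α' + 2 ≤ β') : False := by
  obtain ⟨c, d, s, t, hb, hys, hzt, hc, hcd, hd, hs, ht⟩ := exists_bridge M hy hz hyj hzj
  have f1 := hy.frame k' α hα
  have f3 := hz.frame k α' hα'
  have f4 := hz.frame k β' hβ'
  have hk'k := hkk'.symm
  have hjk := hkj.symm
  have hjk' := hk'j.symm
  have hne := hz.ne k' α (by omega)
  refine false_of_three_legs hnt (u := p k' α) (v := z) hne.symm (fun e => hzk _ e.symm)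
    ((M.ipath_down k' (Nat.zero_le (α - 1)) (by omega)).join
      (M.ipath_up k (Nat.zero_le α') (by omega)) ?_ ?_)
    ((M.ipath_up k' (show α + 1 ≤ L k' by omega) le_rfl).join
      (M.ipath_down k (show β' ≤ L k by omega) le_rfl) ?_ ?_)
    ((IPath.single y).join hb hys ?_)
    ?_ ?_ ?_ ?_ ?_ ?_ ?_ ?_ ?_ ?_ ?_ ?_ ?_ ?_ ?_ ?_ ?_ ?_
  repeat' first
    | omega
    | assumption
    | exact SimpleGraph.Adj.symm (by assumption)
    | exact SimpleGraph.Adj.ne (by assumption)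
    | exact SimpleGraph.Adj.ne' (by assumption)
    | apply Only.union_left
    | apply Only.union_right
    | refine M.only_diff (by assumption) ?_ ?_ ?_ ?_
    | refine M.only_lt (by omega) ?_ ?_
    | refine M.only_gt (by omega) ?_ ?_
    | refine M.only_single_diff (by assumption) ?_ ?_ ?_
    | refine M.only_single_lt (by omega) ?_ ?_
    | refine M.only_single_gt (by omega) ?_ ?_
    | refine M.adj_diff _ _ (by assumption) _ _ (by omega) (by omega) |>.2 (by omega)
    | refine M.adj_same _ _ _ (by omega) (by omega) |>.2 (by omega)
    | refine Outer.only_seg (by assumption) ?_ ?_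
    | refine Outer.seg_only (by assumption) ?_ ?_
    | refine Only.anticomplete ?_
    | refine only_single_single ?_ ?_
    | grind [SimpleGraph.adj_comm]

lemma false_of_one_one (M : Model G p L) (hh : 2 ≤ h) (hnt : ¬ HasLongTheta G (2 * h + 2))
    {k k' j : Fin 3} (hkk' : k ≠ k') (hkj : k ≠ j) (hk'j : k' ≠ j) {y z : V}
    (hy : Outer G p L h y) (hz : Outer G p L h z) (hyz : y ≠ z) (hna : ¬ G.Adj y z)
    (hyk : ∀ m, ¬ G.Adj y (p k m)) (hzk : ∀ m, ¬ G.Adj z (p k' m))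
    (hyj : ∃ m, G.Adj y (p j m)) (hzj : ∃ m, G.Adj z (p j m)) {α α' : ℕ}
    (hα : G.Adj y (p k' α)) (hα₁ : ∀ n, G.Adj y (p k' n) → n = α)
    (hα' : G.Adj z (p k α')) (hα₁' : ∀ n, G.Adj z (p k n) → n = α') : False := by
  obtain ⟨c, d, s, t, hb, hys, hzt, hc, hcd, hd, hs, ht⟩ := exists_bridge M hy hz hyj hzj
  have f1 := hy.frame k' α hα
  have f3 := hz.frame k α' hα'
  have hk'k := hkk'.symm
  have hjk := hkj.symm
  have hjk' := hk'j.symm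
  refine false_of_three_legs hnt (u := p k' α) (v := p k α')
    (M.ne_diff _ _ hk'k _ _ (by omega) (by omega))
    (fun e => by have := (M.adj_diff _ _ hk'k _ _ (by omega) (by omega)).1 e; omega)
    ((M.ipath_down k' (Nat.zero_le (α - 1)) (by omega)).join
      (M.ipath_up k (Nat.zero_le (α' - 1)) (by omega)) ?_ ?_)
    ((M.ipath_up k' (show α + 1 ≤ L k' by omega) le_rfl).join
      (M.ipath_down k (show α' + 1 ≤ L k by omega) le_rfl) ?_ ?_)
    (((IPath.single y).join hb hys ?_).join (IPath.single z) hzt.symm ?_)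
    ?_ ?_ ?_ ?_ ?_ ?_ ?_ ?_ ?_ ?_ ?_ ?_ ?_ ?_ ?_ ?_ ?_ ?_
  repeat' first
    | omega
    | assumption
    | exact SimpleGraph.Adj.symm (by assumption)
    | exact SimpleGraph.Adj.ne (by assumption)
    | exact SimpleGraph.Adj.ne' (by assumption)
    | apply Only.union_left
    | apply Only.union_right
    | refine M.only_diff (by assumption) ?_ ?_ ?_ ?_
    | refine M.only_lt (by omega) ?_ ?_
    | refine M.only_gt (by omega) ?_ ?_
    | refine M.only_single_diff (by assumption) ?_ ?_ ?_
    | refine M.only_single_lt (by omega) ?_ ?_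
    | refine M.only_single_gt (by omega) ?_ ?_
    | refine M.adj_diff _ _ (by assumption) _ _ (by omega) (by omega) |>.2 (by omega)
    | refine M.adj_same _ _ _ (by omega) (by omega) |>.2 (by omega)
    | refine Outer.only_seg (by assumption) ?_ ?_
    | refine Outer.seg_only (by assumption) ?_ ?_
    | refine Only.anticomplete ?_
    | refine only_single_single ?_ ?_
    | grind [SimpleGraph.adj_comm]

lemma false_of_spread_pair (M : Model G p L) (hh : 2 ≤ h) (hnt : ¬ HasLongTheta G (2 * h + 2))
    {i j k : Fin 3} (hij : i ≠ j) (hik : i ≠ k) (hjk : j ≠ k) {x y : V}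
    (hx : Outer G p L h x) (hy : Outer G p L h y) (hxy : x ≠ y) (hna : ¬ G.Adj x y)
    (hyk : ∀ m, ¬ G.Adj y (p k m)) (hxj : ∃ m, G.Adj x (p j m)) (hyj : ∃ m, G.Adj y (p j m))
    {α γ u v : ℕ} (hα : G.Adj x (p i α)) (hα₁ : ∀ n, G.Adj x (p i n) → α ≤ n)
    (hγ : G.Adj x (p k γ)) (hγ₁ : ∀ n, G.Adj x (p k n) → γ ≤ n)
    (hv : G.Adj y (p i v)) (hv₁ : ∀ n, G.Adj y (p i n) → v ≤ n)
    (hu : G.Adj y (p i u)) (hu₁ : ∀ n ≤ α, G.Adj y (p i n) → n ≤ u)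
    (huα : u + (2 * h + 1) ≤ α) (huv : v + 2 ≤ u) : False := by
  obtain ⟨c, d, s, t, hb, hys, hxt, hc, hcd, hd, hs, ht⟩ := exists_bridge M hy hx hyj hxj
  have f1 := hx.frame i α hα
  have f2 := hx.frame k γ hγ
  have f3 := hy.frame i v hv
  have hji := hij.symm
  have hki := hik.symm
  have hkj := hjk.symm
  refine false_of_three_legs hnt hxy.symm (fun e => hna e.symm)
    (M.ipath_up i (show u ≤ α by omega) (by omega))
    ((M.ipath_down i (Nat.zero_le v) (by omega)).join
      (M.ipath_up k (Nat.zero_le γ) (by omega)) ?_ ?_) hb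
    ?_ ?_ ?_ ?_ ?_ ?_ ?_ ?_ ?_ ?_ ?_ ?_ ?_ ?_ ?_ ?_ ?_ ?_
  repeat' first
    | omega
    | assumption
    | exact SimpleGraph.Adj.symm (by assumption)
    | exact SimpleGraph.Adj.ne (by assumption)
    | exact SimpleGraph.Adj.ne' (by assumption)
    | apply Only.union_left
    | apply Only.union_right
    | refine M.only_diff (by assumption) ?_ ?_ ?_ ?_
    | refine M.only_lt (by omega) ?_ ?_
    | refine M.only_gt (by omega) ?_ ?_
    | refine M.only_single_diff (by assumption) ?_ ?_ ?_
    | refine M.only_single_lt (by omega) ?_ ?_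
    | refine M.only_single_gt (by omega) ?_ ?_
    | refine M.adj_diff _ _ (by assumption) _ _ (by omega) (by omega) |>.2 (by omega)
    | refine M.adj_same _ _ _ (by omega) (by omega) |>.2 (by omega)
    | refine Outer.only_seg (by assumption) ?_ ?_
    | refine Outer.seg_only (by assumption) ?_ ?_
    | refine Only.anticomplete ?_
    | refine only_single_single ?_ ?_
    | grind [SimpleGraph.adj_comm]

lemma false_of_single_neighbour (M : Model G p L) (hh : 2 ≤ h)
    (hnt : ¬ HasLongTheta G (2 * h + 2))
    {i j k : Fin 3} (hij : i ≠ j) (hik : i ≠ k) (hjk : j ≠ k) {x y : V}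
    (hx : Outer G p L h x) (hy : Outer G p L h y) (hxy : x ≠ y) (hna : ¬ G.Adj x y)
    (hyk : ∀ m, ¬ G.Adj y (p k m)) (hxj : ∃ m, G.Adj x (p j m)) (hyj : ∃ m, G.Adj y (p j m))
    {α γ u : ℕ} (hα : G.Adj x (p i α)) (hα₁ : ∀ n, G.Adj x (p i n) → α ≤ n)
    (hγ : G.Adj x (p k γ)) (hγ₁ : ∀ n, G.Adj x (p k n) → γ ≤ n)
    (hu : G.Adj y (p i u)) (hu₁ : ∀ n ≤ α, G.Adj y (p i n) → n = u)
    (huα : u + (2 * h + 1) ≤ α) : False := by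
  obtain ⟨c, d, s, t, hb, hys, hxt, hc, hcd, hd, hs, ht⟩ := exists_bridge M hy hx hyj hxj
  have f1 := hx.frame i α hα
  have f2 := hx.frame k γ hγ
  have f3 := hy.frame i u hu
  have hji := hij.symm
  have hki := hik.symm
  have hkj := hjk.symm
  have hne := hx.ne i u (by omega)
  have hxu : ¬ G.Adj x (p i u) := fun e => by have := hα₁ u e; omega
  refine false_of_three_legs hnt (u := p i u) (v := x) hne.symm (fun e => hxu e.symm)
    (M.ipath_up i (show u + 1 ≤ α by omega) (by omega))
    ((M.ipath_down i (Nat.zero_le (u - 1)) (by omega)).join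
      (M.ipath_up k (Nat.zero_le γ) (by omega)) ?_ ?_)
    ((IPath.single y).join hb hys ?_)
    ?_ ?_ ?_ ?_ ?_ ?_ ?_ ?_ ?_ ?_ ?_ ?_ ?_ ?_ ?_ ?_ ?_ ?_
  repeat' first
    | omega
    | assumption
    | exact SimpleGraph.Adj.symm (by assumption)
    | exact SimpleGraph.Adj.ne (by assumption)
    | exact SimpleGraph.Adj.ne' (by assumption)
    | apply Only.union_left
    | apply Only.union_right
    | refine M.only_diff (by assumption) ?_ ?_ ?_ ?_
    | refine M.only_lt (by omega) ?_ ?_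
    | refine M.only_gt (by omega) ?_ ?_
    | refine M.only_single_diff (by assumption) ?_ ?_ ?_
    | refine M.only_single_lt (by omega) ?_ ?_
    | refine M.only_single_gt (by omega) ?_ ?_
    | refine M.adj_diff _ _ (by assumption) _ _ (by omega) (by omega) |>.2 (by omega)
    | refine M.adj_same _ _ _ (by omega) (by omega) |>.2 (by omega)
    | refine Outer.only_seg (by assumption) ?_ ?_
    | refine Outer.seg_only (by assumption) ?_ ?_
    | refine Only.anticomplete ?_
    | refine only_single_single ?_ ?_
    | grind [SimpleGraph.adj_comm]

lemma false_of_two_initial_hits [Finite V] (M : Model G p L) (hh : 2 ≤ h) {i j k : Fin 3}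
    (hij : i ≠ j) (hik : i ≠ k) (hjk : j ≠ k)
    (hmin : NoSmallerLNP G (2 * h + 2) (L i + L j + L k + 3)) {x y : V}
    (hx : Outer G p L h x) (hy : Outer G p L h y) (hxy : x ≠ y) (hna : ¬ G.Adj x y)
    (hyk : ∀ m, ¬ G.Adj y (p k m))
    {α γ δ v w : ℕ} (hα : G.Adj x (p i α)) (hα₁ : ∀ n, G.Adj x (p i n) → α ≤ n)
    (hγ : G.Adj x (p k γ)) (hγ₁ : ∀ n, G.Adj x (p k n) → γ ≤ n)
    (hδ₁ : ∀ n, G.Adj x (p j n) → δ ≤ n)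
    (hv : G.Adj y (p i v)) (hv' : G.Adj y (p i (v + 1)))
    (hvv : ∀ n ≤ α, G.Adj y (p i n) → n = v ∨ n = v + 1) (hvα : v + 1 + (2 * h + 1) ≤ α)
    (hw : G.Adj y (p j w)) (hw₁ : ∀ n, G.Adj y (p j n) → w ≤ n)
    (hwδ : w + (2 * h + 1) ≤ δ) : False := by
  have f1 := hx.frame i α hα
  have f2 := hx.frame k γ hγ
  have f3 := hy.frame i v hv
  have f4 := hy.frame j w hw
  have hji := hij.symm
  have hki := hik.symm
  have hkj := hjk.symm
  have hna' : ¬ G.Adj y x := fun e => hna e.symm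
  refine hmin.elim (by omega) (M.ipath_down i (Nat.zero_le v) (by omega))
    (((M.ipath_up i (show v + 1 ≤ α by omega) (by omega)).join (IPath.single x) ?_ ?_).join
      (M.ipath_down k (Nat.zero_le γ) (by omega)) hγ ?_)
    ((IPath.single y).join (M.ipath_down j (Nat.zero_le w) (by omega)) hw ?_)
    ?_ ?_ ?_ ?_ ?_ ?_ ?_ ?_ ?_ ?_ ?_ ?_ ?_
  repeat' first
    | omega
    | assumption
    | exact SimpleGraph.Adj.symm (by assumption)
    | exact SimpleGraph.Adj.ne (by assumption)
    | exact SimpleGraph.Adj.ne' (by assumption)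
    | apply Only.union_left
    | apply Only.union_right
    | refine M.only_diff (by assumption) ?_ ?_ ?_ ?_
    | refine M.only_lt (by omega) ?_ ?_
    | refine M.only_gt (by omega) ?_ ?_
    | refine M.only_single_diff (by assumption) ?_ ?_ ?_
    | refine M.only_single_lt (by omega) ?_ ?_
    | refine M.only_single_gt (by omega) ?_ ?_
    | refine M.adj_diff _ _ (by assumption) _ _ (by omega) (by omega) |>.2 (by omega)
    | refine M.adj_same _ _ _ (by omega) (by omega) |>.2 (by omega)
    | refine Outer.only_seg (by assumption) ?_ ?_
    | refine Outer.seg_only (by assumption) ?_ ?_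
    | refine Only.anticomplete ?_
    | refine only_single_single ?_ ?_
    | grind [SimpleGraph.adj_comm]

lemma false_of_different_pairs [Finite V] (M : Model G p L) (hh : 2 ≤ h) {i j k : Fin 3}
    (hij : i ≠ j)
    (hmin : NoSmallerLNP G (2 * h + 2) (L i + L j + L k + 3)) {x y z : V}
    (hx : Outer G p L h x) (hy : Outer G p L h y) (hz : Outer G p L h z)
    (hxy : x ≠ y) (hna : ¬ G.Adj x y) (hxz : x ≠ z) (hna' : ¬ G.Adj x z) (hyz : G.Adj y z)
    {α γ v w : ℕ} (hα : G.Adj x (p i α)) (hα₁ : ∀ n, G.Adj x (p i n) → α ≤ n)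
    (hγ : G.Adj x (p j γ)) (hγ₁ : ∀ n, G.Adj x (p j n) → γ ≤ n)
    (hv : G.Adj y (p i v)) (hv' : G.Adj y (p i (v + 1)))
    (hvv : ∀ n ≤ α, G.Adj y (p i n) → n = v ∨ n = v + 1) (hvα : v + 1 + (2 * h + 1) ≤ α)
    (hyj : ∀ n ≤ γ, ¬ G.Adj y (p j n))
    (hw : G.Adj z (p j w)) (hw' : G.Adj z (p j (w + 1)))
    (hww : ∀ n ≤ γ, G.Adj z (p j n) → n = w ∨ n = w + 1) (hwγ : w + 1 + (2 * h + 1) ≤ γ)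
    (hzi : ∀ n ≤ α, ¬ G.Adj z (p i n)) : False := by
  have f1 := hx.frame i α hα
  have f2 := hx.frame j γ hγ
  have f3 := hy.frame i v hv
  have f4 := hz.frame j w hw
  have hji := hij.symm
  have hyx : ¬ G.Adj y x := fun e => hna e.symm
  have hzx : ¬ G.Adj z x := fun e => hna' e.symm
  refine hmin.elim (by omega)
    ((M.ipath_down i (Nat.zero_le v) (by omega)).join
      (M.ipath_up j (Nat.zero_le w) (by omega)) ?_ ?_)
    (((M.ipath_up i (show v + 1 ≤ α by omega) (by omega)).join (IPath.single x) ?_ ?_).join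
      (M.ipath_down j (show w + 1 ≤ γ by omega) (by omega)) hγ ?_)
    ((IPath.single y).join (IPath.single z) hyz ?_)
    ?_ ?_ ?_ ?_ ?_ ?_ ?_ ?_ ?_ ?_ ?_ ?_ ?_
  repeat' first
    | omega
    | assumption
    | exact SimpleGraph.Adj.symm (by assumption)
    | exact SimpleGraph.Adj.ne (by assumption)
    | exact SimpleGraph.Adj.ne' (by assumption)
    | apply Only.union_left
    | apply Only.union_right
    | refine M.only_diff (by assumption) ?_ ?_ ?_ ?_
    | refine M.only_lt (by omega) ?_ ?_
    | refine M.only_gt (by omega) ?_ ?_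
    | refine M.only_single_diff (by assumption) ?_ ?_ ?_
    | refine M.only_single_lt (by omega) ?_ ?_
    | refine M.only_single_gt (by omega) ?_ ?_
    | refine M.adj_diff _ _ (by assumption) _ _ (by omega) (by omega) |>.2 (by omega)
    | refine M.adj_same _ _ _ (by omega) (by omega) |>.2 (by omega)
    | refine Outer.only_seg (by assumption) ?_ ?_
    | refine Outer.seg_only (by assumption) ?_ ?_
    | refine Only.anticomplete ?_
    | refine only_single_single ?_ ?_
    | grind [SimpleGraph.adj_comm]

lemma false_of_ordered_pairs (M : Model G p L) (hh : 2 ≤ h)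
    (hnt : ¬ HasLongTheta G (2 * h + 2))
    {j k k' : Fin 3} (hjk : j ≠ k) (hjk' : j ≠ k') (hkk' : k ≠ k') {x y z : V}
    (hx : Outer G p L h x) (hy : Outer G p L h y) (hz : Outer G p L h z)
    (hxy : x ≠ y) (hna : ¬ G.Adj x y) (hxz : x ≠ z) (hna' : ¬ G.Adj x z) (hyz : G.Adj y z)
    (hyk : ∀ m, ¬ G.Adj y (p k m)) (hzk' : ∀ m, ¬ G.Adj z (p k' m))
    (hxk' : ∃ m, G.Adj x (p k' m)) (hyk' : ∃ m, G.Adj y (p k' m))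
    {α γ v w : ℕ} (hα : G.Adj x (p j α)) (hα₁ : ∀ n, G.Adj x (p j n) → α ≤ n)
    (hγ : G.Adj x (p k γ)) (hγ₁ : ∀ n, G.Adj x (p k n) → γ ≤ n)
    (hzk : ∀ n ≤ γ, ¬ G.Adj z (p k n))
    (hv : G.Adj y (p j v))
    (hvv : ∀ n ≤ α, G.Adj y (p j n) → n = v ∨ n = v + 1)
    (hw' : G.Adj z (p j (w + 1)))
    (hww : ∀ n ≤ α, G.Adj z (p j n) → n = w ∨ n = w + 1) (hwα : w + 1 + (2 * h + 1) ≤ α)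
    (hvw : v < w) : False := by
  obtain ⟨c, d, s, t, hb, hys, hxt, hc, hcd, hd, hs, ht⟩ := exists_bridge M hy hx hyk' hxk'
  have f1 := hx.frame j α hα
  have f2 := hx.frame k γ hγ
  have f3 := hy.frame j v hv
  have hkj := hjk.symm
  have hk'j := hjk'.symm
  have hk'k := hkk'.symm
  have hyx : ¬ G.Adj y x := fun e => hna e.symm
  have hzx : ¬ G.Adj z x := fun e => hna' e.symm
  refine false_of_three_legs hnt hxy.symm hyx
    ((M.ipath_down j (Nat.zero_le v) (by omega)).join
      (M.ipath_up k (Nat.zero_le γ) (by omega)) ?_ ?_)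
    ((IPath.single z).join (M.ipath_up j (show w + 1 ≤ α by omega) (by omega)) hw' ?_) hb
    ?_ ?_ ?_ ?_ ?_ ?_ ?_ ?_ ?_ ?_ ?_ ?_ ?_ ?_ ?_ ?_ ?_ ?_
  repeat' first
    | omega
    | assumption
    | exact SimpleGraph.Adj.symm (by assumption)
    | exact SimpleGraph.Adj.ne (by assumption)
    | exact SimpleGraph.Adj.ne' (by assumption)
    | apply Only.union_left
    | apply Only.union_right
    | refine M.only_diff (by assumption) ?_ ?_ ?_ ?_
    | refine M.only_lt (by omega) ?_ ?_
    | refine M.only_gt (by omega) ?_ ?_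
    | refine M.only_single_diff (by assumption) ?_ ?_ ?_
    | refine M.only_single_lt (by omega) ?_ ?_
    | refine M.only_single_gt (by omega) ?_ ?_
    | refine M.adj_diff _ _ (by assumption) _ _ (by omega) (by omega) |>.2 (by omega)
    | refine M.adj_same _ _ _ (by omega) (by omega) |>.2 (by omega)
    | refine Outer.only_seg (by assumption) ?_ ?_
    | refine Outer.seg_only (by assumption) ?_ ?_
    | refine Only.anticomplete ?_
    | refine only_single_single ?_ ?_
    | grind [SimpleGraph.adj_comm]

lemma false_of_equal_first [Finite V] (M : Model G p L) (hh : 2 ≤ h)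
    {j k k' : Fin 3} (hjk : j ≠ k) (hjk' : j ≠ k') (hkk' : k ≠ k')
    (hmin : NoSmallerLNP G (2 * h + 2) (L j + L k + L k' + 3)) {y z : V}
    (hy : Outer G p L h y) (hz : Outer G p L h z) (hyz : G.Adj y z)
    (hyk : ∀ m, ¬ G.Adj y (p k m)) (hzk' : ∀ m, ¬ G.Adj z (p k' m)) {v β γ : ℕ}
    (hv : G.Adj y (p j v)) (hv' : G.Adj z (p j v))
    (hv₁ : ∀ n, G.Adj y (p j n) → v ≤ n) (hv₁' : ∀ n, G.Adj z (p j n) → v ≤ n)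
    (hβ : G.Adj y (p k' β)) (hβ₁ : ∀ n, G.Adj y (p k' n) → β ≤ n)
    (hγ : G.Adj z (p k γ)) (hγ₁ : ∀ n, G.Adj z (p k n) → γ ≤ n) : False := by
  have f1 := hy.frame j v hv
  have f2 := hy.frame k' β hβ
  have f3 := hz.frame k γ hγ
  have hkj := hjk.symm
  have hk'j := hjk'.symm
  have hk'k := hkk'.symm
  refine hmin.elim (by omega) (M.ipath_down j (Nat.zero_le v) (by omega))
    ((IPath.single y).join (M.ipath_down k' (Nat.zero_le β) (by omega)) hβ ?_)
    ((IPath.single z).join (M.ipath_down k (Nat.zero_le γ) (by omega)) hγ ?_)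
    ?_ ?_ ?_ ?_ ?_ ?_ ?_ ?_ ?_ ?_ ?_ ?_ ?_
  repeat' first
    | omega
    | assumption
    | exact SimpleGraph.Adj.symm (by assumption)
    | exact SimpleGraph.Adj.ne (by assumption)
    | exact SimpleGraph.Adj.ne' (by assumption)
    | apply Only.union_left
    | apply Only.union_right
    | refine M.only_diff (by assumption) ?_ ?_ ?_ ?_
    | refine M.only_lt (by omega) ?_ ?_
    | refine M.only_gt (by omega) ?_ ?_
    | refine M.only_single_diff (by assumption) ?_ ?_ ?_
    | refine M.only_single_lt (by omega) ?_ ?_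
    | refine M.only_single_gt (by omega) ?_ ?_
    | refine M.adj_diff _ _ (by assumption) _ _ (by omega) (by omega) |>.2 (by omega)
    | refine Outer.only_seg (by assumption) ?_ ?_
    | refine Outer.seg_only (by assumption) ?_ ?_
    | refine Only.anticomplete ?_
    | refine only_single_single ?_ ?_
    | grind [SimpleGraph.adj_comm]

lemma exists_third (i j : Fin 3) (hij : i ≠ j) :
    ∃ k, i ≠ k ∧ j ≠ k ∧ ∀ m, m = i ∨ m = j ∨ m = k := by
  revert i j
  decide

/-- The neighbours of `q` on the three paths are not confined to three consecutive vertices of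
a single path. -/
def Spread (G : SimpleGraph V) (p : Fin 3 → ℕ → V) (q : V) : Prop :=
  ∀ k, (∀ i, i ≠ k → ∀ m, ¬ G.Adj q (p i m)) →
    ∃ m n, G.Adj q (p k m) ∧ G.Adj q (p k n) ∧ m + 3 ≤ n

/-- The sum of the lengths of the three paths is minimum among long near-prisms, and at most one
of them is short. -/
structure Minimal (G : SimpleGraph V) (p : Fin 3 → ℕ → V) (L : Fin 3 → ℕ) (h : ℕ) : Prop where
  model : Model G p L
  two_le : 2 ≤ h
  no_smaller : ∀ i j k, i ≠ j → i ≠ k → j ≠ k →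
    NoSmallerLNP G (2 * h + 2) (L i + L j + L k + 3)
  long : ∀ i j, i ≠ j → 2 * h + 2 ≤ L i ∨ 2 * h + 2 ≤ L j

lemma Minimal.hits [Finite V] (K : Minimal G p L h) {q : V} (hq : Outer G p L h q)
    (hs : Spread G p q) {i j : Fin 3} (hij : i ≠ j) (hi : ∀ m, ¬ G.Adj q (p i m)) :
    ∃ m, G.Adj q (p j m) := by
  by_contra! hj
  obtain ⟨k, hik, hjk, hall⟩ := exists_third i j hij
  obtain ⟨m, n, hm, hn, hmn⟩ := hs k fun l hl => by
    rcases hall l with rfl | rfl | rfl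
    exacts [hi, hj, absurd rfl hl]
  obtain ⟨α, hα, hα₁⟩ := exists_first ⟨m, hm⟩
  obtain ⟨β, hβ, hβ₁⟩ := hq.exists_last ⟨m, hm⟩
  exact false_of_one_hit K.model K.two_le hij hik hjk (K.no_smaller i j k hij hik hjk)
    (K.long i j hij) hq hi hj hα hβ hα₁ hβ₁ (by have := hα₁ m hm; have := hβ₁ n hn; omega)

lemma Minimal.adj_of_miss [Finite V] (K : Minimal G p L h) (hnt : ¬ HasLongTheta G (2 * h + 2))
    {y z : V} (hy : Outer G p L h y) (hz : Outer G p L h z) (hsy : Spread G p y)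
    (hsz : Spread G p z) {k k' : Fin 3} (hkk' : k ≠ k') (hyk : ∀ m, ¬ G.Adj y (p k m))
    (hzk : ∀ m, ¬ G.Adj z (p k' m)) : G.Adj y z := by
  by_contra hna
  obtain ⟨j, hkj, hk'j, -⟩ := exists_third k k' hkk'
  have hyk' := K.hits hy hsy hkk' hyk
  have hyj := K.hits hy hsy hkj hyk
  have hzk' := K.hits hz hsz hkk'.symm hzk
  have hzj := K.hits hz hsz hk'j hzk
  have hyz : y ≠ z := by
    rintro rfl
    obtain ⟨m, hm⟩ := hzk'
    exact hyk m hm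
  have M := K.model
  have hh := K.two_le
  obtain ⟨α, hα, hα₁⟩ := exists_first hyk'
  obtain ⟨β, hβ, hβ₁⟩ := hy.exists_last hyk'
  obtain ⟨α', hα', hα₁'⟩ := exists_first hzk'
  obtain ⟨β', hβ', hβ₁'⟩ := hz.exists_last hzk'
  have hc : β ≠ α + 1 := by
    rintro rfl
    obtain ⟨m, hm, hm₁⟩ := exists_first hyj
    exact false_of_consecutive M hh hk'j hkk'.symm hkj.symm
      (K.no_smaller _ _ _ hk'j hkk'.symm hkj.symm) hy hyk hα hβ
      (fun n hn => by have := hα₁ n hn; have := hβ₁ n hn; omega) hm hm₁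
  have hc' : β' ≠ α' + 1 := by
    rintro rfl
    obtain ⟨m, hm, hm₁⟩ := exists_first hzj
    exact false_of_consecutive M hh hkj hkk' hk'j.symm
      (K.no_smaller _ _ _ hkj hkk' hk'j.symm) hz hzk hα' hβ'
      (fun n hn => by have := hα₁' n hn; have := hβ₁' n hn; omega) hm hm₁
  have h1 := hα₁ β hβ
  have h2 := hα₁' β' hβ'
  by_cases h3 : α + 2 ≤ β <;> by_cases h4 : α' + 2 ≤ β'
  · exact false_of_two_two M hh hnt hkk' hkj hk'j hy hz hyz hna hyk hzk hyj hzj hα hβ hα₁ hβ₁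
      hα' hβ' hα₁' hβ₁' h3 h4
  · exact false_of_one_two M hh hnt hkk'.symm hk'j hkj hz hy hyz.symm (fun e => hna e.symm)
      hzk hyk hzj hyj hα' (fun n hn => by have := hα₁' n hn; have := hβ₁' n hn; omega)
      hα hβ hα₁ hβ₁ h3
  · exact false_of_one_two M hh hnt hkk' hkj hk'j hy hz hyz hna
      hyk hzk hyj hzj hα (fun n hn => by have := hα₁ n hn; have := hβ₁ n hn; omega)
      hα' hβ' hα₁' hβ₁' h4
  · exact false_of_one_one M hh hnt hkk' hkj hk'j hy hz hyz hna
      hyk hzk hyj hzj hα (fun n hn => by have := hα₁ n hn; have := hβ₁ n hn; omega)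
      hα' (fun n hn => by have := hα₁' n hn; have := hβ₁' n hn; omega)

/-- `y` is not adjacent to `x`, has a neighbour weakly before the first neighbour of `x` on one
of the paths if `x` has neighbours on all of them, and every such neighbour is far from the first
neighbour of `x`. -/
structure Far (G : SimpleGraph V) (p : Fin 3 → ℕ → V) (h : ℕ) (x y : V) : Prop where
  not_adj : ¬ G.Adj x y
  gap : ∀ i m n, G.Adj x (p i n) → (∀ l, G.Adj x (p i l) → n ≤ l) → G.Adj y (p i m) → m ≤ n →
    m + (2 * h + 1) ≤ n
  initial : (∀ i, ∃ m, G.Adj x (p i m)) → ∃ i m, G.Adj y (p i m) ∧ ∀ n, G.Adj x (p i n) → m ≤ n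

lemma Minimal.exists_pair [Finite V] (K : Minimal G p L h) (hnt : ¬ HasLongTheta G (2 * h + 2))
    {x y : V} (hx : Outer G p L h x) (hy : Outer G p L h y) (hxy : x ≠ y) (hsy : Spread G p y)
    (hf : Far G p h x y) {α : Fin 3 → ℕ} (hα : ∀ i, G.Adj x (p i (α i)))
    (hα₁ : ∀ i n, G.Adj x (p i n) → α i ≤ n) {i k : Fin 3} (hik : i ≠ k)
    (hyk : ∀ m, ¬ G.Adj y (p k m)) (hyi : ∃ m ≤ α i, G.Adj y (p i m)) :
    ∃ v, G.Adj y (p i v) ∧ G.Adj y (p i (v + 1)) ∧ (∀ n, G.Adj y (p i n) → v ≤ n) ∧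
      (∀ n ≤ α i, G.Adj y (p i n) → n = v ∨ n = v + 1) ∧ v + 1 + (2 * h + 1) ≤ α i := by
  obtain ⟨j, hij, hkj, -⟩ := exists_third i k hik
  have hyj := K.hits hy hsy hkj hyk
  obtain ⟨u, hu, hyu, hu₁⟩ := exists_last_le hyi
  obtain ⟨v, hv, hv₁⟩ := exists_first (hyi.imp fun _ => And.right)
  have hvu := hv₁ u hyu
  have hgap := hf.gap i u (α i) (hα i) (hα₁ i) hyu hu
  have h1 : ¬ v + 2 ≤ u := fun h1 => false_of_spread_pair K.model K.two_le hnt hij hik hkj.symm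
    hx hy hxy hf.not_adj hyk ⟨_, hα j⟩ hyj (hα i) (hα₁ i) (hα k) (hα₁ k) hv hv₁ hyu hu₁ hgap h1
  have h2 : u ≠ v := by
    rintro rfl
    exact false_of_single_neighbour K.model K.two_le hnt hij hik hkj.symm
      hx hy hxy hf.not_adj hyk ⟨_, hα j⟩ hyj (hα i) (hα₁ i) (hα k) (hα₁ k) hyu
      (fun n hn hyn => le_antisymm (hu₁ n hn hyn) (hv₁ n hyn)) hgap
  obtain rfl : u = v + 1 := by omega
  exact ⟨v, hv, hyu, hv₁, fun n hn hyn => by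
    have := hu₁ n hn hyn; have := hv₁ n hyn; omega, hgap⟩

lemma Minimal.exists_unique_pair [Finite V] (K : Minimal G p L h)
    (hnt : ¬ HasLongTheta G (2 * h + 2))
    {x y : V} (hx : Outer G p L h x) (hy : Outer G p L h y) (hxy : x ≠ y) (hsy : Spread G p y)
    (hf : Far G p h x y) {α : Fin 3 → ℕ} (hα : ∀ i, G.Adj x (p i (α i)))
    (hα₁ : ∀ i n, G.Adj x (p i n) → α i ≤ n) {k : Fin 3} (hyk : ∀ m, ¬ G.Adj y (p k m)) :
    ∃ i v, i ≠ k ∧ G.Adj y (p i v) ∧ G.Adj y (p i (v + 1)) ∧ (∀ n, G.Adj y (p i n) → v ≤ n) ∧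
      (∀ n ≤ α i, G.Adj y (p i n) → n = v ∨ n = v + 1) ∧ v + 1 + (2 * h + 1) ≤ α i ∧
      ∀ j, j ≠ i → ∀ n ≤ α j, ¬ G.Adj y (p j n) := by
  obtain ⟨i, m, him, hm⟩ := hf.initial fun i => ⟨_, hα i⟩
  have hik : i ≠ k := by
    rintro rfl
    exact hyk m him
  obtain ⟨v, hv, hv', hv₁, hvv, hva⟩ := K.exists_pair hnt hx hy hxy hsy hf hα hα₁ hik hyk
    ⟨m, hm _ (hα i), him⟩
  refine ⟨i, v, hik, hv, hv', hv₁, hvv, hva, fun j hji n hn hjn => ?_⟩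
  have hjk : j ≠ k := by
    rintro rfl
    exact hyk n hjn
  obtain ⟨w, hw, hw', hw₁, hww, hwa⟩ := K.exists_pair hnt hx hy hxy hsy hf hα hα₁ hjk hyk
    ⟨n, hn, hjn⟩
  exact false_of_two_initial_hits K.model K.two_le hji.symm hik hjk
    (K.no_smaller _ _ _ hji.symm hik hjk) hx hy hxy hf.not_adj hyk (hα i) (hα₁ i) (hα k) (hα₁ k)
    (hα₁ j) hv hv' hvv hva hw hw₁ (by omega)

lemma Minimal.eq_of_miss [Finite V] (K : Minimal G p L h) (hnt : ¬ HasLongTheta G (2 * h + 2))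
    {x y z : V} (hx : Outer G p L h x) (hy : Outer G p L h y) (hz : Outer G p L h z)
    (hsx : Spread G p x) (hsy : Spread G p y) (hsz : Spread G p z)
    (hfy : Far G p h x y) (hfz : Far G p h x z) {k k' : Fin 3}
    (hyk : ∀ m, ¬ G.Adj y (p k m)) (hzk : ∀ m, ¬ G.Adj z (p k' m)) : k = k' := by
  by_contra hkk'
  have hall : ∀ i, ∃ m, G.Adj x (p i m) := by
    intro i
    by_contra! hi
    by_cases hik : i = k
    · exact hfz.not_adj (K.adj_of_miss hnt hx hz hsx hsz (hik ▸ hkk') hi hzk)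
    · exact hfy.not_adj (K.adj_of_miss hnt hx hy hsx hsy hik hi hyk)
  have hxy : x ≠ y := by
    rintro rfl
    obtain ⟨m, hm⟩ := hall k
    exact hyk m hm
  have hxz : x ≠ z := by
    rintro rfl
    obtain ⟨m, hm⟩ := hall k'
    exact hzk m hm
  have hyz := K.adj_of_miss hnt hy hz hsy hsz hkk' hyk hzk
  choose α hα hα₁ using fun i => exists_first (hall i)
  obtain ⟨i, v, hik, hv, hv', hv₁, hvv, hva, hyo⟩ :=
    K.exists_unique_pair hnt hx hy hxy hsy hfy hα hα₁ hyk
  obtain ⟨j, w, hjk, hw, hw', hw₁, hww, hwa, hzo⟩ :=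
    K.exists_unique_pair hnt hx hz hxz hsz hfz hα hα₁ hzk
  have M := K.model
  have hh := K.two_le
  by_cases hij : i = j
  · subst hij
    rcases lt_trichotomy v w with h1 | rfl | h1
    · exact false_of_ordered_pairs M hh hnt hik hjk hkk' hx hy hz hxy hfy.not_adj hxz
        hfz.not_adj hyz hyk hzk (hall k') (K.hits hy hsy hkk' hyk) (hα i) (hα₁ i) (hα k) (hα₁ k)
        (hzo k hik.symm) hv hvv hw' hww hwa h1
    · obtain ⟨β, hβ, hβ₁⟩ := exists_first (K.hits hy hsy hkk' hyk)
      obtain ⟨γ, hγ, hγ₁⟩ := exists_first (K.hits hz hsz (Ne.symm hkk') hzk)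
      exact false_of_equal_first M hh hik hjk hkk' (K.no_smaller _ _ _ hik hjk hkk') hy hz hyz
        hyk hzk hv hw hv₁ hw₁ hβ hβ₁ hγ hγ₁
    · exact false_of_ordered_pairs M hh hnt hjk hik (Ne.symm hkk') hx hz hy hxz hfz.not_adj hxy
        hfy.not_adj hyz.symm hzk hyk (hall k) (K.hits hz hsz (Ne.symm hkk') hzk) (hα i) (hα₁ i)
        (hα k') (hα₁ k') (hyo k' hjk.symm) hw hww hv' hvv hva h1
  · obtain ⟨l, hil, hjl, -⟩ := exists_third i j hij
    exact false_of_different_pairs M hh hij (K.no_smaller i j l hij hil hjl) hx hy hz hxy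
      hfy.not_adj hxz hfz.not_adj hyz (hα i) (hα₁ i) (hα j) (hα₁ j) hv hv' hvv hva
      (hyo j (Ne.symm hij)) hw hw' hww hwa (hzo i hij)

lemma IsHole.eq_of_adj {u : V} {c : G.Walk u u} (hc : IsHole c) {v w₁ w₂ w₃ : V}
    (hv : v ∈ c.support) (h₁ : w₁ ∈ c.support) (h₂ : w₂ ∈ c.support) (h₃ : w₃ ∈ c.support)
    (a₁ : G.Adj v w₁) (a₂ : G.Adj v w₂) (a₃ : G.Adj v w₃) : w₁ = w₂ ∨ w₁ = w₃ ∨ w₂ = w₃ := by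
  obtain ⟨s, t, -, hst⟩ := Set.ncard_eq_two.1 (hc.1.ncard_neighborSet_toSubgraph_eq_two hv)
  have key : ∀ w ∈ c.support, G.Adj v w → w = s ∨ w = t := fun w hw ha => by
    have : w ∈ c.toSubgraph.neighborSet v :=
      (Walk.mem_edges_toSubgraph c).2 (hc.2.2 v hv w hw ha)
    rwa [hst] at this
  have := key _ h₁ a₁
  have := key _ h₂ a₂
  have := key _ h₃ a₃
  grind

variable {a b : Fin 3 → V} {P : ∀ i : Fin 3, G.Walk (a i) (b i)} {ℓ : ℕ}

lemma IsLongNearPrism.model (hK : IsLongNearPrism ℓ a b P) :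
    Model G (fun i => (P i).getVert) (fun i => (P i).length) := by
  obtain ⟨ha, hb, -, hp, hd, hh⟩ := hK
  have deg : ∀ i j, i ≠ j → ∀ v w₁ w₂ w₃, v ∈ (P i).support → (w₁ ∈ vset (P i) ∪ vset (P j)) →
      (w₂ ∈ vset (P i) ∪ vset (P j)) → (w₃ ∈ vset (P i) ∪ vset (P j)) →
      G.Adj v w₁ → G.Adj v w₂ → G.Adj v w₃ → w₁ = w₂ ∨ w₁ = w₃ ∨ w₂ = w₃ := by
    intro i j hij v w₁ w₂ w₃ hv h₁ h₂ h₃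
    obtain ⟨u, c, hc, -, hs⟩ := hh i j hij
    rw [← hs] at h₁ h₂ h₃
    have hv' : v ∈ vset (P i) ∪ vset (P j) := Or.inl hv
    rw [← hs] at hv'
    exact hc.eq_of_adj hv' h₁ h₂ h₃
  have inj : ∀ i m n, m ≤ (P i).length → n ≤ (P i).length →
      ((P i).getVert m = (P i).getVert n ↔ m = n) := fun i m n hm hn =>
    ⟨fun e => (hp i).getVert_injOn hm hn e, fun e => by rw [e]⟩
  have ne : ∀ i j, i ≠ j → ∀ m n, (P i).getVert m ≠ (P j).getVert n := fun i j hij m n e =>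
    hd i j hij _ ((P i).getVert_mem_support m) (e ▸ (P j).getVert_mem_support n)
  have hin : ∀ i m, (P i).getVert m ∈ vset (P i) := fun i m => (P i).getVert_mem_support m
  have hsucc : ∀ i m, m < (P i).length → G.Adj ((P i).getVert m) ((P i).getVert (m + 1)) :=
    fun i m hm => (P i).adj_getVert_succ hm
  have h0 : ∀ i j, i ≠ j → G.Adj ((P i).getVert 0) ((P j).getVert 0) := fun i j hij => by
    simpa using ha i j hij
  have hL : ∀ i j, i ≠ j → G.Adj ((P i).getVert (P i).length) ((P j).getVert (P j).length) :=
    fun i j hij => by simpa using hb i j hij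
  have hprev : ∀ i j, i ≠ j → ∀ m, m ≤ (P i).length → ∃ w ∈ vset (P i) ∪ vset (P j),
      G.Adj ((P i).getVert m) w ∧
        (m = 0 ∧ w = (P j).getVert 0 ∨ 0 < m ∧ w = (P i).getVert (m - 1)) := by
    intro i j hij m hm
    rcases Nat.eq_zero_or_pos m with rfl | hm0
    · exact ⟨_, Or.inr (hin j 0), h0 i j hij, Or.inl ⟨rfl, rfl⟩⟩
    · refine ⟨_, Or.inl (hin i (m - 1)), ?_, Or.inr ⟨hm0, rfl⟩⟩
      have := hsucc i (m - 1) (by omega)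
      rw [show m - 1 + 1 = m by omega] at this
      exact this.symm
  have hnext : ∀ i j, i ≠ j → ∀ m, m ≤ (P i).length → ∃ w ∈ vset (P i) ∪ vset (P j),
      G.Adj ((P i).getVert m) w ∧ (m = (P i).length ∧ w = (P j).getVert (P j).length ∨
        m < (P i).length ∧ w = (P i).getVert (m + 1)) := by
    intro i j hij m hm
    rcases Nat.eq_or_lt_of_le hm with rfl | hm0
    · exact ⟨_, Or.inr (hin j _), hL i j hij, Or.inl ⟨rfl, rfl⟩⟩
    · exact ⟨_, Or.inl (hin i (m + 1)), hsucc i m hm0, Or.inr ⟨hm0, rfl⟩⟩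
  have far : ∀ i m n, m + 1 < n → n ≤ (P i).length →
      ¬ G.Adj ((P i).getVert m) ((P i).getVert n) := by
    intro i m n hmn hn hadj
    obtain ⟨j, hji⟩ := exists_ne i
    have hij := hji.symm
    obtain ⟨w, hw, hmw, h⟩ := hprev i j hij m (by omega)
    have h1 := deg i j hij _ _ _ _ (hin i m) hw (Or.inl (hin i n)) (Or.inl (hin i (m + 1)))
      hmw hadj (hsucc i m (by omega))
    have e1 := inj i n (m + 1) (by omega) (by omega)
    have e2 := inj i (m - 1) n (by omega) (by omega)
    have e3 := inj i (m - 1) (m + 1) (by omega) (by omega)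
    have n1 := ne i j hij n 0
    have n2 := ne i j hij (m + 1) 0
    grind
  refine ⟨?_, ?_, inj, fun i j hij m n _ _ => ne i j hij m n⟩
  · intro i m n hm hn
    constructor
    · intro hadj
      by_contra! hne
      rcases lt_trichotomy m n with h | rfl | h
      · exact far i m n (by omega) hn hadj
      · exact G.irrefl hadj
      · exact far i n m (by omega) hm hadj.symm
    · rintro (rfl | rfl)
      · exact hsucc i m (by omega)
      · exact (hsucc i n (by omega)).symm
  · intro i j hij m n hm hn
    constructor
    · intro hadj
      obtain ⟨w, hw, hmw, h⟩ := hprev i j hij m hm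
      obtain ⟨w', hw', hmw', h'⟩ := hnext i j hij m hm
      have h1 := deg i j hij _ _ _ _ (hin i m) hw hw' (Or.inr (hin j n)) hmw hmw' hadj
      have e1 := inj i (m - 1) (m + 1)
      have e2 := inj j 0 n (by omega) hn
      have e3 := inj j (P j).length n le_rfl hn
      have e4 := inj j 0 (P j).length (by omega) le_rfl
      have n1 := ne i j hij (m - 1) n
      have n2 := ne i j hij (m + 1) n
      have n3 := ne i j hij (m - 1) (P j).length
      have n4 := ne i j hij (m + 1) 0
      grind
    · rintro (⟨rfl, rfl⟩ | ⟨rfl, rfl⟩)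
      exacts [h0 i j hij, hL i j hij]

lemma IsLongNearPrism.ncard_prismSupport (hK : IsLongNearPrism ℓ a b P) {i j k : Fin 3}
    (hij : i ≠ j) (hik : i ≠ k) (hjk : j ≠ k) :
    (prismSupport P).ncard = (P i).length + (P j).length + (P k).length + 3 := by
  classical
  have hfin : ∀ i, (vset (P i)).Finite := fun i => (P i).support.finite_toSet
  have hcard : ∀ i, (vset (P i)).ncard = (P i).length + 1 := by
    intro i
    have : vset (P i) = ((P i).support.toFinset : Set V) := by ext; simp [vset]
    rw [this, Set.ncard_coe_finset, ← Walk.length_support,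
      List.toFinset_card_of_nodup (hK.2.2.2.1 i).support_nodup]
  have hdisj : ∀ i j, i ≠ j → Disjoint (vset (P i)) (vset (P j)) := fun i j hij =>
    Set.disjoint_left.2 fun v hv => hK.2.2.2.2.1 i j hij v hv
  have hU : prismSupport P = vset (P i) ∪ vset (P j) ∪ vset (P k) := by
    obtain ⟨l, -, -, hl⟩ := exists_third i j hij
    have hall : ∀ m, m = i ∨ m = j ∨ m = k := by
      have := hl k
      grind
    ext v
    simp only [prismSupport, Set.mem_iUnion, Set.mem_union]
    constructor
    · rintro ⟨m, hm⟩
      rcases hall m with rfl | rfl | rfl <;> tauto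
    · rintro ((h | h) | h)
      exacts [⟨_, h⟩, ⟨_, h⟩, ⟨_, h⟩]
  rw [hU, Set.ncard_union_eq (Set.disjoint_union_left.2 ⟨hdisj _ _ hik, hdisj _ _ hjk⟩)
      ((hfin i).union (hfin j)) (hfin k), Set.ncard_union_eq (hdisj _ _ hij) (hfin i) (hfin j),
    hcard, hcard, hcard]
  omega

lemma ShortestLNP.minimal {h : ℕ} (hh : 2 ≤ h) (hK : ShortestLNP G (2 * h + 2) P)
    (ht : Tidy G (2 * h + 2) P) :
    Minimal G (fun i => (P i).getVert) (fun i => (P i).length) h where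
  model := hK.1.model
  two_le := hh
  no_smaller i j k hij hik hjk a' b' P' hP' := by
    rw [← hK.1.ncard_prismSupport hij hik hjk]
    exact hK.2 a' b' P' hP'
  long i j hij := by
    by_contra! hc
    exact hij (ht.1 i j (by omega) (by omega))

lemma mem_frameStar {h : ℕ} {i : Fin 3} {m : ℕ} (hm : m ≤ (P i).length)
    (hf : m < h ∨ (P i).length < m + h ∨ (P i).length ≤ 2 * h + 1) :
    (P i).getVert m ∈ frameStar (2 * h + 2) P := by
  rw [frameStar, Set.mem_iUnion]
  refine ⟨i, ?_⟩
  have h2 : (2 * h + 2) / 2 - 1 = h := by omega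
  rw [h2]
  split_ifs with hs
  · exact (P i).getVert_mem_support m
  · rcases hf with hf | hf | hf
    · refine Or.inl (List.mem_take_iff_getElem.2 ⟨m, ?_, ?_⟩)
      · rw [Walk.length_support]; omega
      · rw [Walk.support_getElem_eq_getVert]
    · refine Or.inr ?_
      rw [Set.mem_ofPred_eq, ← Walk.support_reverse]
      refine List.mem_take_iff_getElem.2 ⟨(P i).length - m, ?_, ?_⟩
      · rw [Walk.length_support, Walk.length_reverse]; omega
      · rw [Walk.support_getElem_eq_getVert, Walk.getVert_reverse]
        congr 1
        omega
    · omega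

lemma mem_frameStar_iff {h : ℕ} (hK : IsLongNearPrism (2 * h + 2) a b P) {i : Fin 3} {m : ℕ}
    (hm : m ≤ (P i).length) : (P i).getVert m ∈ frameStar (2 * h + 2) P ↔
      m < h ∨ (P i).length < m + h ∨ (P i).length ≤ 2 * h + 1 := by
  refine ⟨fun hf => ?_, mem_frameStar hm⟩
  rw [frameStar, Set.mem_iUnion] at hf
  obtain ⟨j, hj⟩ := hf
  have h2 : (2 * h + 2) / 2 - 1 = h := by omega
  rw [h2] at hj
  have hmem : (P i).getVert m ∈ (P j).support := by
    split_ifs at hj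
    · exact hj
    · rcases hj with hj | hj
      · exact List.mem_of_mem_take hj
      · exact List.mem_reverse.1 (List.mem_of_mem_take hj)
  obtain rfl : i = j := by
    by_contra hij
    exact hK.2.2.2.2.1 i j hij _ ((P i).getVert_mem_support m) hmem
  split_ifs at hj with hs
  · omega
  · rcases hj with hj | hj
    · obtain ⟨n, hn, e⟩ := List.mem_take_iff_getElem.1 hj
      rw [Walk.length_support] at hn
      rw [Walk.support_getElem_eq_getVert] at e
      have := (hK.2.2.2.1 i).getVert_injOn (show n ≤ (P i).length by omega) hm e
      omega
    · rw [Set.mem_ofPred_eq, ← Walk.support_reverse] at hj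
      obtain ⟨n, hn, e⟩ := List.mem_take_iff_getElem.1 hj
      rw [Walk.length_support, Walk.length_reverse] at hn
      rw [Walk.support_getElem_eq_getVert, Walk.getVert_reverse] at e
      have := (hK.2.2.2.1 i).getVert_injOn (show (P i).length - n ≤ (P i).length by omega) hm e
      omega

lemma Tidy.outer {h : ℕ} (hh : 1 ≤ h) (ht : Tidy G (2 * h + 2) P) {q : V}
    (hq : q ∉ prismSupport P) :
    Outer G (fun i => (P i).getVert) (fun i => (P i).length) h q where
  ne i m _ := by
    rintro rfl
    exact hq (Set.mem_iUnion.2 ⟨i, (P i).getVert_mem_support m⟩)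
  frame i m hm := by
    by_contra hc
    have hmin : (P i).getVert m = (P i).getVert (min m (P i).length) := by
      rcases le_total m (P i).length with h1 | h1
      · rw [min_eq_left h1]
      · rw [min_eq_right h1, (P i).getVert_of_length_le h1, Walk.getVert_length]
    refine (ht.2 (mem_frameStar (h := h) (i := i) (m := min m (P i).length)
      (min_le_right _ _) (by omega)) hq).2 ?_
    rw [← hmin]
    exact hm.symm

lemma exists_prismGraph_walk (hp : ∀ i, (P i).IsPath) (i : Fin 3) {m n : ℕ} (hmn : m ≤ n)
    (hn : n ≤ (P i).length) :
    ∃ (x y : V) (W : (prismGraph G a b P).Walk x y), W.IsPath ∧ W.length = n - m ∧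
      ∀ l, m ≤ l → l ≤ n → (P i).getVert l ∈ W.support := by
  have hedge : ∀ e ∈ (((P i).drop m).take (n - m)).edges, e ∈ (prismGraph G a b P).edgeSet := by
    intro e he
    have h1 : e ∈ (P i).edges := by
      have := (((P i).drop m).isSubwalk_take (n - m)).edges_isInfix.subset he
      exact ((P i).isSubwalk_drop m).edges_isInfix.subset this
    rw [prismGraph, edgeSet_fromEdgeSet]
    exact ⟨Or.inr ⟨i, h1⟩, G.not_isDiag_of_mem_edgeSet ((P i).edges_subset_edgeSet h1)⟩
  refine ⟨_, _, (((P i).drop m).take (n - m)).transfer _ hedge,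
    (((hp i).drop m).take (n - m)).transfer hedge, ?_, fun l h1 h2 => ?_⟩
  · rw [Walk.length_transfer, Walk.take_length, Walk.drop_length]
    omega
  · rw [Walk.support_transfer, Walk.mem_support_iff_exists_getVert]
    refine ⟨l - m, ?_, ?_⟩
    · rw [Walk.take_getVert, Walk.drop_getVert]
      congr 1
      omega
    · rw [Walk.take_length, Walk.drop_length]
      omega

lemma KMajor.spread {q : V} (hp : ∀ i, (P i).IsPath) (hq : KMajor G P q) :
    Spread G (fun i => (P i).getVert) q := by
  intro k hk
  by_contra! hc
  have hsupp : ∀ z ∈ prismSupport P, G.Adj q z →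
      ∃ m ≤ (P k).length, z = (P k).getVert m := by
    intro z hz hqz
    obtain ⟨i, hi⟩ := Set.mem_iUnion.1 hz
    obtain ⟨m, rfl, hm⟩ := Walk.mem_support_iff_exists_getVert.1 hi
    by_cases hik : i = k
    · subst hik
      exact ⟨m, hm, rfl⟩
    · exact absurd hqz (hk i hik m)
  refine hq.2 ?_
  by_cases hex : ∃ m ≤ (P k).length, G.Adj q ((P k).getVert m)
  · obtain ⟨n, hn, hqn, hn₁⟩ := exists_last_le (p := fun i => (P i).getVert) hex
    obtain ⟨m, hqm, hm₁⟩ := exists_first (p := fun i => (P i).getVert) ⟨n, hqn⟩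
    have := hc m n hqm hqn
    obtain ⟨x, y, W, hW, hlen, hmem⟩ := exists_prismGraph_walk hp k (hm₁ n hqn) hn
    refine ⟨x, y, W, hW, by omega, fun z hz hqz => ?_⟩
    obtain ⟨l, hl, rfl⟩ := hsupp z hz hqz
    exact hmem l (hm₁ l hqz) (hn₁ l hl hqz)
  · refine ⟨q, q, .nil, .nil, by simp, fun z hz hqz => ?_⟩
    obtain ⟨l, hl, rfl⟩ := hsupp z hz hqz
    exact absurd ⟨l, hl, hqz⟩ hex

lemma firstNbrIdx_support {u v x : V} (W : G.Walk u v) {n : ℕ} (hn : n ≤ W.length)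
    (hx : G.Adj x (W.getVert n)) (hx₁ : ∀ l, G.Adj x (W.getVert l) → n ≤ l) :
    firstNbrIdx G W.support x = n := by
  rw [firstNbrIdx, List.findIdx_eq (by rw [Walk.length_support]; omega)]
  refine ⟨by simpa [Walk.support_getElem_eq_getVert] using hx, fun l hl => ?_⟩
  rw [Walk.support_getElem_eq_getVert, decide_eq_false_iff_not]
  intro h
  have := hx₁ l h
  omega

lemma listIdx_support {u v : V} {W : G.Walk u v} (hW : W.IsPath) {n : ℕ} (hn : n ≤ W.length) :
    listIdx W.support (W.getVert n) = n := by
  rw [listIdx, List.findIdx_eq (by rw [Walk.length_support]; omega)]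
  refine ⟨by simp [Walk.support_getElem_eq_getVert], fun l hl => ?_⟩
  rw [Walk.support_getElem_eq_getVert, decide_eq_false_iff_not]
  intro h
  have := hW.getVert_injOn (show l ≤ W.length by omega) hn h
  omega

lemma support_getD {u v : V} (W : G.Walk u v) {n : ℕ} (hn : n ≤ W.length) (d : V) :
    W.support.getD n d = W.getVert n := by
  rw [List.getD_eq_getElem _ _ (by rw [Walk.length_support]; omega),
    Walk.support_getElem_eq_getVert]

lemma Distant.far {h : ℕ} (hh : 1 ≤ h) (hK : IsLongNearPrism (2 * h + 2) a b P)
    (ht : Tidy G (2 * h + 2) P) {x y : V} (hx : x ∉ prismSupport P) (hy : y ∉ prismSupport P)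
    (hd : Distant G (2 * h + 2) P x y) : Far G (fun i => (P i).getVert) h x y := by
  have ox := ht.outer hh hx
  have oy := ht.outer hh hy
  refine ⟨hd.1, ?_, ?_⟩
  · intro i m n hn hn₁ hm hmn
    by_contra hc
    have fn := ox.frame i n hn
    have fm := oy.frame i m hm
    have hnL : n ≤ (P i).length := by omega
    have hα : alpha G (P i) x = (P i).getVert n := by
      rw [alpha, firstNbrIdx_support (P i) hnL hn hn₁, support_getD _ hnL]
    refine hd.2.2.1 i ⟨_, (P i).getVert_mem_support n, hn⟩ ((P i).getVert m) ?_ hm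
    rw [hα, Kmn, listIdx_support (hK.2.2.2.1 i) hnL]
    refine Or.inl ⟨m, hmn, by omega, fun l h1 h2 => ?_, (support_getD _ (by omega) _).symm⟩
    rw [support_getD _ (by omega), mem_frameStar_iff hK (by omega)]
    omega
  · intro hall
    obtain ⟨z, hz, hyz⟩ := hd.2.1
    obtain ⟨i, hi⟩ := Set.mem_iUnion.1 hz
    obtain ⟨n, hn, hn₁⟩ := exists_first (p := fun i => (P i).getVert) (hall i)
    have hnL : n ≤ (P i).length := by
      have := ox.frame i n hn
      omega
    rw [Aset, if_pos ⟨_, (P i).getVert_mem_support n, hn⟩,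
      firstNbrIdx_support (P i) hnL hn hn₁] at hi
    obtain ⟨m, hm, rfl⟩ := List.mem_take_iff_getElem.1 hi
    rw [Walk.support_getElem_eq_getVert] at hyz
    exact ⟨i, m, hyz, fun l hl => by have := hn₁ l hl; omega⟩
end LEH
open LEH

/-- if `y, z` are both distant from `x`, `y` misses `V(P i)` and `z` misses
`V(P j)`, then `i = j`. -/
theorem twoclosetwos {V : Type*} [Fintype V]
    (ℓ : ℕ) (hℓ : 6 ≤ ℓ) (hℓeven : Even ℓ)
    (G : SimpleGraph V) (hnt : ¬ HasLongTheta G ℓ)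
    {a b : Fin 3 → V} (P : ∀ i : Fin 3, G.Walk (a i) (b i))
    (hsh : ShortestLNP G ℓ P) (htidy : Tidy G ℓ P)
    (x y z : V) (hx : KMajor G P x) (hy : KMajor G P y) (hz : KMajor G P z)
    (hdy : Distant G ℓ P x y) (hdz : Distant G ℓ P x z) :
    ∀ i j : Fin 3, (∀ w ∈ (P i).support, ¬ G.Adj y w) →
      (∀ w ∈ (P j).support, ¬ G.Adj z w) → i = j := by
  intro i j hi hj
  obtain ⟨h, rfl⟩ : ∃ h, ℓ = 2 * h + 2 := by
    obtain ⟨m, rfl⟩ := hℓeven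
    exact ⟨m - 1, by omega⟩
  have hh : 2 ≤ h := by omega
  have hp := hsh.1.2.2.2.1
  exact (hsh.minimal hh htidy).eq_of_miss hnt (htidy.outer (by omega) hx.1)
    (htidy.outer (by omega) hy.1) (htidy.outer (by omega) hz.1) (hx.spread hp) (hy.spread hp)
    (hz.spread hp) (hdy.far (by omega) hsh.1 htidy hx.1 hy.1)
    (hdz.far (by omega) hsh.1 htidy hx.1 hz.1)
    (fun m => hi _ ((P i).getVert_mem_support m)) (fun m => hj _ ((P j).getVert_mem_support m))
end

section
/- Let G be a candidate, let C be a shortest long even hole in G, and let x be a C-major vertex. Then x has three pairwise nonadjacent neighbours in V(C), and for every path Q of C with three vertices, x has at least two neighbours in V(C) \ V(Q). -/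
open SimpleGraph

open LEH

namespace LEH

section Construction

variable {V : Type*} {G : SimpleGraph V}

lemma exists_walk_of_adj_succ (m : ℕ) (g : ℕ → V) (hg : ∀ i < m, G.Adj (g i) (g (i + 1))) :
    ∃ P : G.Walk (g 0) (g m), P.support = (List.range (m + 1)).map g ∧
      P.edges = (List.range m).map fun i => s(g i, g (i + 1)) := by
  induction m generalizing g with
  | zero => exact ⟨.nil, by simp, by simp⟩
  | succ m ih =>
    obtain ⟨P, hs, he⟩ := ih (fun i => g (i + 1)) fun i hi => hg (i + 1) (by omega)
    refine ⟨.cons (hg 0 (by omega)) P, ?_, ?_⟩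
    · rw [Walk.support_cons, hs, List.range_succ_eq_map (n := m + 1)]
      simp [Function.comp_def]
    · rw [Walk.edges_cons, he, List.range_succ_eq_map (n := m)]
      simp [Function.comp_def]

lemma exists_inducedPath {m : ℕ} {g : ℕ → V} {u v : V} (hu : g 0 = u) (hv : g m = v)
    (hne : ∀ i j, i < j → j ≤ m → g i ≠ g j)
    (hadj : ∀ i j, i < j → j ≤ m → (G.Adj (g i) (g j) ↔ j = i + 1)) :
    ∃ P : G.Walk u v, IsInducedPath P ∧ P.length = m ∧
      ∀ z, z ∈ P.support ↔ ∃ i ≤ m, z = g i := by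
  subst hu hv
  obtain ⟨P, hs, he⟩ :=
    exists_walk_of_adj_succ m g fun i hi => (hadj i (i + 1) (by omega) hi).2 rfl
  have hmem : ∀ z, z ∈ P.support ↔ ∃ i ≤ m, z = g i := by
    intro z
    simp only [hs, List.mem_map, List.mem_range, Nat.lt_succ_iff]
    exact ⟨fun ⟨i, hi, h⟩ => ⟨i, hi, h.symm⟩, fun ⟨i, hi, h⟩ => ⟨i, hi, h.symm⟩⟩
  have hedge : ∀ i < m, s(g i, g (i + 1)) ∈ P.edges := by
    intro i hi
    rw [he]
    exact List.mem_map.2 ⟨i, List.mem_range.2 hi, rfl⟩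
  refine ⟨P, ⟨?_, ?_⟩, ?_, hmem⟩
  · rw [Walk.isPath_def, hs]
    refine List.Nodup.map_on ?_ List.nodup_range
    intro i hi j hj hij
    simp only [List.mem_range] at hi hj
    rcases lt_trichotomy i j with h | h | h
    · exact absurd hij (hne i j h (by omega))
    · exact h
    · exact absurd hij.symm (hne j i h (by omega))
  · intro y hy z hz hyz
    obtain ⟨i, hi, rfl⟩ := (hmem y).1 hy
    obtain ⟨j, hj, rfl⟩ := (hmem z).1 hz
    rcases lt_trichotomy i j with h | rfl | h
    · obtain rfl := (hadj i j h hj).1 hyz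
      exact hedge i (by omega)
    · exact absurd hyz (G.loopless.irrefl _)
    · obtain rfl := (hadj j i h hi).1 hyz.symm
      rw [Sym2.eq_swap]
      exact hedge j (by omega)
  · rw [← Walk.length_edges, he]
    simp

lemma exists_hole {n : ℕ} {g : ℕ → V} (hn : 4 ≤ n)
    (hne : ∀ i j, i < j → j < n → g i ≠ g j)
    (hadj : ∀ i j, i < j → j < n → (G.Adj (g i) (g j) ↔ j = i + 1 ∨ i = 0 ∧ j = n - 1)) :
    ∃ (u : V) (c : G.Walk u u), IsHole c ∧ c.length = n ∧
      ∀ z, z ∈ c.support ↔ ∃ i < n, z = g i := by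
  obtain ⟨P, hs, he⟩ := exists_walk_of_adj_succ (n - 1) g
    fun i hi => (hadj i (i + 1) (by omega) (by omega)).2 (.inl rfl)
  rw [Nat.sub_add_cancel (by omega)] at hs
  have hlast : G.Adj (g (n - 1)) (g 0) :=
    ((hadj 0 (n - 1) (by omega) (by omega)).2 (.inr ⟨rfl, rfl⟩)).symm
  have inj : ∀ i < n, ∀ j < n, g i = g j → i = j := by
    intro i hi j hj hij
    rcases lt_trichotomy i j with h | h | h
    · exact absurd hij (hne i j h hj)
    · exact h
    · exact absurd hij.symm (hne j i h hi)
  have hmem : ∀ z, z ∈ (Walk.cons hlast P).support ↔ ∃ i < n, z = g i := by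
    intro z
    simp only [Walk.support_cons, hs, List.mem_cons, List.mem_map, List.mem_range]
    constructor
    · rintro (rfl | ⟨i, hi, rfl⟩)
      · exact ⟨n - 1, by omega, rfl⟩
      · exact ⟨i, hi, rfl⟩
    · rintro ⟨i, hi, rfl⟩
      exact .inr ⟨i, hi, rfl⟩
  have hedge : ∀ i j, i < j → j < n → G.Adj (g i) (g j) →
      s(g i, g j) ∈ (Walk.cons hlast P).edges := by
    intro i j hij hj h
    rw [Walk.edges_cons, he]
    rcases (hadj i j hij hj).1 h with rfl | ⟨rfl, rfl⟩
    · exact List.mem_cons_of_mem _ (List.mem_map.2 ⟨i, List.mem_range.2 (by omega), rfl⟩)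
    · rw [Sym2.eq_swap]
      exact List.mem_cons_self
  refine ⟨_, .cons hlast P, ⟨?_, ?_, ?_⟩, ?_, hmem⟩
  · rw [Walk.cons_isCycle_iff, Walk.isPath_def, hs, he]
    refine ⟨List.Nodup.map_on ?_ List.nodup_range, ?_⟩
    · intro i hi j hj
      exact inj i (List.mem_range.1 hi) j (List.mem_range.1 hj)
    · simp only [List.mem_map, List.mem_range, Sym2.eq_iff, not_exists, not_and]
      rintro i hi (⟨h, h'⟩ | ⟨h, h'⟩)
      · have := inj _ (by omega) _ (by omega) h
        omega
      · have := inj _ (by omega) _ (by omega) h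
        have := inj _ (by omega) _ (by omega) h'
        omega
  · rw [← Walk.length_edges, Walk.edges_cons, he]
    simp
    omega
  · intro y hy z hz hyz
    obtain ⟨i, hi, rfl⟩ := (hmem y).1 hy
    obtain ⟨j, hj, rfl⟩ := (hmem z).1 hz
    rcases lt_trichotomy i j with h | rfl | h
    · exact hedge i j h hj hyz
    · exact absurd hyz (G.loopless.irrefl _)
    · rw [Sym2.eq_swap]
      exact hedge j i h hi hyz.symm
  · rw [← Walk.length_edges, Walk.edges_cons, he]
    simp
    omega

lemma exists_inducedPath_two {u v x : V} (huv : u ≠ v) (hadj : ¬ G.Adj u v)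
    (hu : G.Adj x u) (hv : G.Adj x v) :
    ∃ P : G.Walk u v, IsInducedPath P ∧ P.length = 2 ∧ inter P ⊆ {x} := by
  refine ⟨.cons hu.symm (.cons hv .nil), ⟨?_, ?_⟩, rfl, ?_⟩
  · simp [Walk.cons_isPath_iff, hu.ne', hv.ne, huv]
  · intro y hy z hz hyz
    simp only [Walk.support_cons, Walk.support_nil, List.mem_cons, List.not_mem_nil,
      or_false] at hy hz
    rcases hy with rfl | rfl | rfl <;> rcases hz with rfl | rfl | rfl <;>
      simp_all [G.adj_comm, Sym2.eq_swap]
  · rintro z ⟨hz, h₁, h₂⟩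
    simpa [h₁, h₂] using hz

end Construction

/-- `f` runs periodically around an induced cycle of length `n`. -/
structure IsHoleParam {V : Type*} (G : SimpleGraph V) (n : ℤ) (f : ℤ → V) : Prop where
  periodic : ∀ i, f (i + n) = f i
  ne : ∀ i j, i < j → j < i + n → f i ≠ f j
  adj_iff : ∀ i j, i < j → j < i + n → (G.Adj (f i) (f j) ↔ j = i + 1 ∨ j + 1 = i + n)

lemma IsHole.exists_param {V : Type*} {G : SimpleGraph V} {u : V} {c : G.Walk u u}
    (hc : IsHole c) :
    ∃ f : ℤ → V, IsHoleParam G c.length f ∧ ∀ z, z ∈ c.support ↔ ∃ i, z = f i := by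
  obtain ⟨hcyc, hlen, hind⟩ := hc
  have inj : ∀ i < c.length, ∀ j < c.length, c.getVert i = c.getVert j → i = j :=
    fun i hi j hj h => hcyc.getVert_injOn' (by simp; omega) (by simp; omega) h
  have hn : (0 : ℤ) < c.length := by omega
  have hlast : c.getVert c.length = c.getVert 0 := by simp
  have hadj : ∀ a b, a < b → b < c.length →
      (G.Adj (c.getVert a) (c.getVert b) ↔ b = a + 1 ∨ a = 0 ∧ b + 1 = c.length) := by
    intro a b hab hb
    constructor
    · intro h
      have h' := hind _ (c.getVert_mem_support a) _ (c.getVert_mem_support b) h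
      rw [← Walk.adj_toSubgraph_iff_mem_edges, Walk.toSubgraph_adj_iff] at h'
      obtain ⟨i, hi, hil⟩ := h'
      by_cases hlt : i + 1 < c.length
      · rcases Sym2.eq_iff.1 hi with ⟨h₁, h₂⟩ | ⟨h₁, h₂⟩ <;>
        · have := inj _ (by omega) _ (by omega) h₁
          have := inj _ (by omega) _ (by omega) h₂
          omega
      · rw [show i + 1 = c.length by omega, hlast] at hi
        rcases Sym2.eq_iff.1 hi with ⟨h₁, h₂⟩ | ⟨h₁, h₂⟩ <;>
        · have := inj _ (by omega) _ (by omega) h₁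
          have := inj _ (by omega) _ (by omega) h₂
          omega
    · rintro (rfl | ⟨rfl, hb'⟩)
      · exact c.adj_getVert_succ (by omega)
      · have := c.adj_getVert_succ hb
        rw [hb', hlast] at this
        exact this.symm
  have hmod : ∀ i : ℤ, ∃ a : ℕ, ∃ t : ℤ, a < c.length ∧ (i % c.length).toNat = a ∧
      i = a + c.length * t := by
    intro i
    have h₁ := Int.emod_nonneg i hn.ne'
    have h₂ := Int.emod_lt_of_pos i hn
    refine ⟨_, i / c.length, by omega, rfl, ?_⟩
    have := Int.emod_add_mul_ediv i c.length
    omega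
  have hquot : ∀ i j : ℤ, i < j → j < i + c.length → ∀ a b : ℕ, ∀ s t : ℤ,
      a < c.length → b < c.length → i = a + c.length * s → j = b + c.length * t →
      (a < b ∧ j - i = b - a) ∨ (b < a ∧ j - i = b + c.length - a) := by
    intro i j hij hji a b s t ha hb hi hj
    have h₁ : s ≤ t := by
      by_contra h
      nlinarith [mul_le_mul_of_nonneg_left (show t + 1 ≤ s by omega) hn.le]
    have h₂ : t ≤ s + 1 := by
      by_contra h
      nlinarith [mul_le_mul_of_nonneg_left (show s + 2 ≤ t by omega) hn.le]
    obtain rfl | rfl : t = s ∨ t = s + 1 := by omega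
    · left; omega
    · right; rw [mul_add] at hj; omega
  refine ⟨fun i => c.getVert (i % c.length).toNat, ⟨?_, ?_, ?_⟩, ?_⟩
  · intro i
    simp
  · intro i j hij hji h
    obtain ⟨a, s, ha, ha', hi⟩ := hmod i
    obtain ⟨b, t, hb, hb', hj⟩ := hmod j
    simp only [ha', hb'] at h
    have := inj _ ha _ hb h
    have := hquot i j hij hji a b s t ha hb hi hj
    omega
  · intro i j hij hji
    obtain ⟨a, s, ha, ha', hi⟩ := hmod i
    obtain ⟨b, t, hb, hb', hj⟩ := hmod j
    simp only [ha', hb']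
    rcases hquot i j hij hji a b s t ha hb hi hj with ⟨h, h'⟩ | ⟨h, h'⟩
    · rw [hadj a b h hb]
      omega
    · rw [G.adj_comm, hadj b a h ha]
      omega
  · intro z
    rw [Walk.mem_support_iff_exists_getVert]
    constructor
    · rintro ⟨k, rfl, hk⟩
      rcases hk.lt_or_eq with hk | rfl
      · refine ⟨k, ?_⟩
        dsimp only
        rw [Int.emod_eq_of_lt (by omega) (by omega)]
        simp
      · exact ⟨0, by simp⟩
    · rintro ⟨i, rfl⟩
      obtain ⟨a, s, ha, ha', hi⟩ := hmod i
      exact ⟨a, by dsimp only; rw [ha'], ha.le⟩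

namespace IsHoleParam

variable {V : Type*} {G : SimpleGraph V} {n : ℤ} {f : ℤ → V}

lemma exists_eq (hf : IsHoleParam G n f) (hn : 0 < n) (k s : ℤ) :
    ∃ k', s ≤ k' ∧ k' < s + n ∧ f k = f k' := by
  obtain ⟨k', ⟨h₁, h₂⟩, h₃⟩ :=
    Function.Periodic.exists_mem_Ico (f := f) (c := n) hf.periodic hn k s
  exact ⟨k', h₁, h₂, h₃⟩

lemma exists_arc (hf : IsHoleParam G n f) {i j : ℤ} (hij : i ≤ j) (hji : j + 2 ≤ i + n)
    {u v : V} (hu : f i = u) (hv : f j = v) :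
    ∃ P : G.Walk u v, IsInducedPath P ∧ (P.length : ℤ) = j - i ∧
      ∀ z, z ∈ P.support ↔ ∃ k, i ≤ k ∧ k ≤ j ∧ z = f k := by
  obtain ⟨P, hP, hlen, hmem⟩ := exists_inducedPath (G := G) (m := (j - i).toNat)
    (g := fun t => f (i + t)) (u := u) (v := v) (by simpa using hu)
    (by rw [← hv]; congr 1; omega)
    (fun a b hab hb => hf.ne _ _ (by omega) (by omega))
    (fun a b hab hb => by rw [hf.adj_iff _ _ (by omega) (by omega)]; omega)
  refine ⟨P, hP, by omega, fun z => ?_⟩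
  rw [hmem]
  constructor
  · rintro ⟨t, ht, rfl⟩
    exact ⟨i + t, by omega, by omega, rfl⟩
  · rintro ⟨k, h₁, h₂, rfl⟩
    exact ⟨(k - i).toNat, by omega, by congr 1; omega⟩

lemma mem_inter_arc {i j : ℤ} {u v : V} {P : G.Walk u v} (hu : f i = u) (hv : f j = v)
    (hP : ∀ z, z ∈ P.support ↔ ∃ k, i ≤ k ∧ k ≤ j ∧ z = f k) {z : V} (hz : z ∈ inter P) :
    ∃ k, i < k ∧ k < j ∧ z = f k := by
  obtain ⟨hz, hzu, hzv⟩ := hz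
  obtain ⟨k, h₁, h₂, rfl⟩ := (hP z).1 hz
  refine ⟨k, lt_of_le_of_ne h₁ ?_, lt_of_le_of_ne h₂ ?_, rfl⟩
  · rintro rfl
    exact hzu hu
  · rintro rfl
    exact hzv hv

lemma exists_reverse_arc (hf : IsHoleParam G n f) {i j : ℤ} (hij : i ≤ j)
    (hji : j + 2 ≤ i + n) {u v : V} (hu : f i = u) (hv : f j = v) :
    ∃ P : G.Walk v u, IsInducedPath P ∧ (P.length : ℤ) = j - i ∧
      ∀ z, z ∈ P.support ↔ ∃ k, i ≤ k ∧ k ≤ j ∧ z = f k := by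
  obtain ⟨P, ⟨hP, hind⟩, hlen, hmem⟩ := hf.exists_arc hij hji hu hv
  refine ⟨P.reverse, ⟨hP.reverse, ?_⟩, by simpa using hlen, by simpa using hmem⟩
  simpa using hind

lemma exists_hole (hf : IsHoleParam G n f) (hn : 4 ≤ n) :
    ∃ (u : V) (c : G.Walk u u), IsHole c ∧ (c.length : ℤ) = n ∧
      ∀ z, z ∈ c.support ↔ ∃ k, z = f k := by
  obtain ⟨u, c, hc, hlen, hmem⟩ := LEH.exists_hole (G := G) (n := n.toNat)
    (g := fun t => f t) (by omega)
    (fun a b hab hb => hf.ne _ _ (by omega) (by omega))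
    (fun a b hab hb => by rw [hf.adj_iff _ _ (by omega) (by omega)]; omega)
  refine ⟨u, c, hc, by omega, fun z => ?_⟩
  rw [hmem]
  constructor
  · rintro ⟨t, ht, rfl⟩
    exact ⟨t, rfl⟩
  · rintro ⟨k, rfl⟩
    obtain ⟨k', h₁, h₂, h₃⟩ := hf.exists_eq (by omega) k 0
    exact ⟨k'.toNat, by omega, by rw [h₃]; congr 1; omega⟩

lemma exists_hole_through (hf : IsHoleParam G n f) {x : V} (hx : ∀ k, f k ≠ x) {i j : ℤ}
    (hij : i + 2 ≤ j) (hji : j + 2 ≤ i + n) (hi : G.Adj x (f i)) (hj : G.Adj x (f j))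
    (hgap : ∀ k, i < k → k < j → ¬ G.Adj x (f k)) :
    ∃ (u : V) (c : G.Walk u u), IsHole c ∧ (c.length : ℤ) = j - i + 2 ∧
      ∀ z, z ∈ c.support ↔ z = x ∨ ∃ k, i ≤ k ∧ k ≤ j ∧ z = f k := by
  obtain ⟨u, c, hc, hlen, hmem⟩ := LEH.exists_hole (G := G) (n := (j - i + 2).toNat)
    (g := fun t => if t = 0 then x else f (i + t - 1)) (by omega)
    (fun a b hab hb => by
      rw [if_neg (show b ≠ 0 by omega)]
      split_ifs with ha
      · exact (hx _).symm
      · exact hf.ne _ _ (by omega) (by omega))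
    (fun a b hab hb => by
      rw [if_neg (show b ≠ 0 by omega)]
      split_ifs with ha
      · subst ha
        rcases eq_or_ne b 1 with rfl | hb₁
        · simpa using hi
        rcases eq_or_ne (i + b - 1) j with hb₂ | hb₂
        · rw [hb₂]
          exact iff_of_true hj (by omega)
        · exact iff_of_false (hgap _ (by omega) (by omega)) (by omega)
      · rw [hf.adj_iff _ _ (by omega) (by omega)]
        omega)
  refine ⟨u, c, hc, by omega, fun z => ?_⟩
  rw [hmem]
  constructor
  · rintro ⟨t, ht, rfl⟩
    split_ifs with h
    · exact .inl rfl
    · exact .inr ⟨i + t - 1, by omega, by omega, rfl⟩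
  · rintro (rfl | ⟨k, h₁, h₂, rfl⟩)
    · exact ⟨0, by omega, by simp⟩
    · refine ⟨(k - i + 1).toNat, by omega, ?_⟩
      rw [if_neg (by omega)]
      congr 1
      omega

lemma not_adj (hf : IsHoleParam G n f) {i j : ℤ} (hij : i + 2 ≤ j) (hji : j + 2 ≤ i + n) :
    ¬ G.Adj (f i) (f j) := by
  rw [hf.adj_iff _ _ (by omega) (by omega)]
  omega

lemma adj_succ (hf : IsHoleParam G n f) (hn : 2 ≤ n) (i : ℤ) : G.Adj (f i) (f (i + 1)) :=
  (hf.adj_iff _ _ (by omega) (by omega)).2 (.inl rfl)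

lemma anticomplete_arcs (hf : IsHoleParam G n f) {i j k l : ℤ} {X Y : Set V}
    (hX : ∀ z ∈ X, ∃ t, i ≤ t ∧ t ≤ j ∧ z = f t)
    (hY : ∀ z ∈ Y, ∃ t, k ≤ t ∧ t ≤ l ∧ z = f t)
    (hjk : j + 2 ≤ k) (hli : l + 2 ≤ i + n) : Anticomplete G X Y := by
  intro y hy z hz
  obtain ⟨s, hs₁, hs₂, rfl⟩ := hX y hy
  obtain ⟨t, ht₁, ht₂, rfl⟩ := hY z hz
  exact ⟨hf.ne _ _ (by omega) (by omega), hf.not_adj (by omega) (by omega)⟩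

end IsHoleParam

/-- `f` parametrizes a shortest long even hole, of length `n`, of a candidate, and `x` is
outside this hole. -/
structure IsShortestParam {V : Type*} (G : SimpleGraph V) (ℓ : ℕ) (n : ℤ) (f : ℤ → V)
    (x : V) : Prop extends IsHoleParam G n f where
  candidate : Candidate G ℓ
  six_le : 6 ≤ ℓ
  two_mul_lt : 2 * ℓ < n
  even : n % 2 = 0
  ne_apex : ∀ k, f k ≠ x
  le_length : ∀ (v : V) (c : G.Walk v v), IsLongEvenHole ℓ c → n ≤ c.length

namespace IsShortestParam

variable {V : Type*} {G : SimpleGraph V} {ℓ : ℕ} {n : ℤ} {f : ℤ → V} {x : V}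

lemma adj_add (h : IsShortestParam G ℓ n f x) (k : ℤ) :
    G.Adj x (f (k + n)) ↔ G.Adj x (f k) := by
  rw [h.periodic]

lemma adj_sub (h : IsShortestParam G ℓ n f x) (k : ℤ) :
    G.Adj x (f (k - n)) ↔ G.Adj x (f k) := by
  rw [← h.adj_add, sub_add_cancel]

lemma not_even_gap (h : IsShortestParam G ℓ n f x) {i j : ℤ} (hij : i + 2 ≤ j)
    (hji : j + 3 ≤ i + n) (hi : G.Adj x (f i)) (hj : G.Adj x (f j))
    (hgap : ∀ k, i < k → k < j → ¬ G.Adj x (f k)) (heven : (j - i) % 2 = 0)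
    (hlong : ℓ ≤ j - i + 2) : False := by
  obtain ⟨u, c, hc, hlen, -⟩ := h.exists_hole_through h.ne_apex hij (by omega) hi hj hgap
  have := h.le_length u c ⟨hc, by omega, by rw [Nat.even_iff]; omega⟩
  omega

lemma not_odd_arc (h : IsShortestParam G ℓ n f x) {i j : ℤ} (hij : i + 3 ≤ j)
    (hlen : j - i ≤ ℓ) (hodd : (j - i) % 2 = 1) (hi : G.Adj x (f i)) (hj : G.Adj x (f j))
    (hgap : ∀ k, j < k → k < i + n → ¬ G.Adj x (f k)) : False := by
  have hn := h.two_mul_lt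
  have hl := h.six_le
  obtain ⟨Q₁, hQ₁, hlen₁, hint₁⟩ := exists_inducedPath_two (h.ne i j (by omega) (by omega))
    (h.not_adj (i := i) (j := j) (by omega) (by omega)) hi hj
  obtain ⟨Q₂, hQ₂, hlen₂, hmem₂⟩ := h.exists_arc (i := i) (j := j) (by omega) (by omega)
    rfl rfl
  obtain ⟨P, hP, hlenP, hmemP⟩ := h.exists_reverse_arc (i := j) (j := i + n) (by omega)
    (by omega) rfl (h.periodic i)
  have hintP : ∀ z ∈ inter P, ∃ k, j < k ∧ k < i + n ∧ z = f k := fun z hz =>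
    IsHoleParam.mem_inter_arc (P := P.reverse) rfl (h.periodic i) (by simpa using hmemP)
      (by simpa [inter, and_comm] using hz)
  refine h.candidate.1.2.1 ⟨_, ?_, f i, f j, Q₁, Q₂, P, h.ne _ _ (by omega) (by omega),
    hQ₁, hQ₂, hP, ?_, rfl, ?_, ?_⟩
  · simp only [Walk.length_support]
    omega
  · rw [Nat.even_iff, Nat.even_iff]
    omega
  · omega
  · intro y hy z hz
    obtain ⟨k, hk₁, hk₂, rfl⟩ := hintP y hy
    rcases hz with hz | hz
    · obtain rfl : z = x := hint₁ hz
      exact ⟨h.ne_apex k, fun hadj => hgap k hk₁ hk₂ hadj.symm⟩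
    · obtain ⟨t, ht₁, ht₂, rfl⟩ := IsHoleParam.mem_inter_arc rfl rfl hmem₂ hz
      exact ⟨(h.ne t k (by omega) (by omega)).symm,
        fun hadj => h.not_adj (i := t) (j := k) (by omega) (by omega) hadj.symm⟩

lemma not_two_nbrs (h : IsShortestParam G ℓ n f x) {i j : ℤ} (hij : i + 3 ≤ j)
    (hji : j + 3 ≤ i + n) (hi : G.Adj x (f i)) (hj : G.Adj x (f j))
    (hgap₁ : ∀ k, i < k → k < j → ¬ G.Adj x (f k))
    (hgap₂ : ∀ k, j < k → k < i + n → ¬ G.Adj x (f k)) : False := by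
  have hn := h.two_mul_lt
  have hl := h.six_le
  have heven := h.even
  have hin : G.Adj x (f (i + n)) := (h.adj_add i).2 hi
  rcases lt_or_ge (j - i + 2) ℓ with hs | hs
  · rcases Int.emod_two_eq_zero_or_one (j - i) with hp | hp
    · exact h.not_even_gap (by omega) (by omega) hj hin hgap₂ (by omega) (by omega)
    · exact h.not_odd_arc hij (by omega) hp hi hj hgap₂
  rcases lt_or_ge (i + n - j + 2) ℓ with ht | ht
  · rcases Int.emod_two_eq_zero_or_one (i + n - j) with hp | hp
    · exact h.not_even_gap (by omega) (by omega) hi hj hgap₁ (by omega) (by omega)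
    · exact h.not_odd_arc (by omega) (by omega) hp hj hin fun k hk₁ hk₂ hk =>
        hgap₁ (k - n) (by omega) (by omega) ((h.adj_sub k).2 hk)
  obtain ⟨Q, hQ, hlenQ, hintQ⟩ := exists_inducedPath_two (h.ne i j (by omega) (by omega))
    (h.not_adj (i := i) (j := j) (by omega) (by omega)) hi hj
  obtain ⟨P₁, hP₁, hlen₁, hmem₁⟩ := h.exists_arc (i := i) (j := j) (by omega) (by omega)
    rfl rfl
  obtain ⟨P₂, hP₂, hlen₂, hmem₂⟩ := h.exists_reverse_arc (i := j) (j := i + n) (by omega)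
    (by omega) rfl (h.periodic i)
  have hint₁ : ∀ z ∈ inter P₁, ∃ k, i < k ∧ k < j ∧ z = f k := fun z hz =>
    IsHoleParam.mem_inter_arc rfl rfl hmem₁ hz
  have hint₂ : ∀ z ∈ inter P₂, ∃ k, j < k ∧ k < i + n ∧ z = f k := fun z hz =>
    IsHoleParam.mem_inter_arc (P := P₂.reverse) rfl (h.periodic i) (by simpa using hmem₂)
      (by simpa [inter, and_comm] using hz)
  refine h.candidate.1.2.2.1 ⟨f i, f j, P₁, P₂, Q, h.ne i j (by omega) (by omega),
    h.not_adj (by omega) (by omega), hP₁, hP₂, hQ, ?_, ?_, ?_, by omega, by omega, by omega⟩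
  · refine h.anticomplete_arcs (i := i + 1) (j := j - 1) (k := j + 1) (l := i + n - 1)
      (fun z hz => ?_) (fun z hz => ?_) (by omega) (by omega)
    · obtain ⟨k, h₁, h₂, rfl⟩ := hint₁ z hz
      exact ⟨k, by omega, by omega, rfl⟩
    · obtain ⟨k, h₁, h₂, rfl⟩ := hint₂ z hz
      exact ⟨k, by omega, by omega, rfl⟩
  · intro y hy z hz
    obtain rfl : z = x := hintQ hz
    obtain ⟨k, h₁, h₂, rfl⟩ := hint₁ y hy
    exact ⟨h.ne_apex k, fun hadj => hgap₁ k h₁ h₂ hadj.symm⟩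
  · intro y hy z hz
    obtain rfl : z = x := hintQ hz
    obtain ⟨k, h₁, h₂, rfl⟩ := hint₂ y hy
    exact ⟨h.ne_apex k, fun hadj => hgap₂ k h₁ h₂ hadj.symm⟩

lemma not_nbr_and_edge (h : IsShortestParam G ℓ n f x) {i j : ℤ} (hij : i + 2 ≤ j)
    (hji : j + 3 ≤ i + n) (hi : G.Adj x (f i)) (hj : G.Adj x (f j))
    (hj' : G.Adj x (f (j + 1)))
    (hgap₁ : ∀ k, i < k → k < j → ¬ G.Adj x (f k))
    (hgap₂ : ∀ k, j + 1 < k → k < i + n → ¬ G.Adj x (f k)) : False := by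
  have hn := h.two_mul_lt
  have hl := h.six_le
  have heven := h.even
  have hin : G.Adj x (f (i + n)) := (h.adj_add i).2 hi
  rcases Int.emod_two_eq_zero_or_one (j - i) with hp | hp
  · rcases lt_or_ge (j - i + 2) ℓ with hs | hs
    · exact h.not_odd_arc (by omega) (by omega) (by omega) hi hj' hgap₂
    · exact h.not_even_gap hij hji hi hj hgap₁ hp hs
  · rcases lt_or_ge (i + n - (j + 1) + 2) ℓ with hs | hs
    · exact h.not_odd_arc (by omega) (by omega) (by omega) hj hin fun k hk₁ hk₂ hk =>
        hgap₁ (k - n) (by omega) (by omega) ((h.adj_sub k).2 hk)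
    · exact h.not_even_gap (by omega) (by omega) hj' hin hgap₂ (by omega) hs

lemma not_two_odd_gaps (h : IsShortestParam G ℓ n f x) {i j : ℤ} (hij : i + 2 ≤ j)
    (hji : j + 4 ≤ i + n) (hs : ℓ ≤ j - i + 2) (ht : ℓ ≤ i + n - j)
    (hi' : G.Adj x (f (i - 1))) (hi : G.Adj x (f i)) (hj : G.Adj x (f j))
    (hj' : G.Adj x (f (j + 1)))
    (hgap₁ : ∀ k, i < k → k < j → ¬ G.Adj x (f k))
    (hgap₂ : ∀ k, j + 1 < k → k < i - 1 + n → ¬ G.Adj x (f k)) : False := by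
  have hn := h.two_mul_lt
  have hl := h.six_le
  have hin' : G.Adj x (f (i - 1 + n)) := (h.adj_add _).2 hi'
  obtain ⟨P₁, hP₁, -, hmem₁⟩ := h.exists_arc (i := i) (j := j) (by omega) (by omega) rfl rfl
  obtain ⟨P₂, hP₂, -, hmem₂⟩ := h.exists_reverse_arc (i := j + 1) (j := i - 1 + n)
    (by omega) (by omega) rfl (h.periodic (i - 1))
  obtain ⟨u₁, c₁, hc₁, hlen₁, hsup₁⟩ :=
    h.exists_hole_through h.ne_apex hij (by omega) hi hj hgap₁
  obtain ⟨u₂, c₂, hc₂, hlen₂, hsup₂⟩ :=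
    h.exists_hole_through h.ne_apex (by omega) (by omega) hj' hin' hgap₂
  obtain ⟨u₃, c₃, hc₃, hlen₃, hsup₃⟩ := h.exists_hole (by omega)
  have hii : G.Adj (f i) (f (i - 1)) := by
    have := h.adj_succ (by omega) (i - 1)
    rw [sub_add_cancel] at this
    exact this.symm
  have hjj : G.Adj (f j) (f (j + 1)) := h.adj_succ (by omega) j
  have hdisj : ∀ z ∈ P₁.support, z ∉ P₂.support := by
    intro z hz hz'
    obtain ⟨s, hs₁, hs₂, rfl⟩ := (hmem₁ z).1 hz
    obtain ⟨t, ht₁, ht₂, hst⟩ := (hmem₂ _).1 hz'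
    exact h.ne s t (by omega) (by omega) hst
  have hx₁ : ∀ z, z = x → z ∉ P₁.support := by
    rintro z rfl hz
    obtain ⟨k, -, -, hk⟩ := (hmem₁ z).1 hz
    exact h.ne_apex k hk.symm
  have hx₂ : ∀ z, z = x → z ∉ P₂.support := by
    rintro z rfl hz
    obtain ⟨k, -, -, hk⟩ := (hmem₂ z).1 hz
    exact h.ne_apex k hk.symm
  have hole₁ : IsLongHoleOn G ℓ (vset (Walk.nil : G.Walk x x) ∪ vset P₁) := by
    refine ⟨u₁, c₁, hc₁, by omega, ?_⟩
    ext z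
    simp [hsup₁, vset, hmem₁]
  have hole₂ : IsLongHoleOn G ℓ (vset (Walk.nil : G.Walk x x) ∪ vset P₂) := by
    refine ⟨u₂, c₂, hc₂, by omega, ?_⟩
    ext z
    simp [hsup₂, vset, hmem₂]
  have hole₃ : IsLongHoleOn G ℓ (vset P₁ ∪ vset P₂) := by
    refine ⟨u₃, c₃, hc₃, by omega, ?_⟩
    ext z
    simp only [hsup₃, vset, hmem₁, hmem₂, Set.mem_ofPred_eq, Set.mem_union]
    constructor
    · rintro ⟨k, rfl⟩
      obtain ⟨k', h₁, h₂, h₃⟩ := h.exists_eq (by omega) k i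
      rcases le_or_gt k' j with hk | hk
      · exact .inl ⟨k', h₁, hk, h₃⟩
      · exact .inr ⟨k', by omega, by omega, h₃⟩
    · rintro (⟨k, -, -, rfl⟩ | ⟨k, -, -, rfl⟩) <;> exact ⟨k, rfl⟩
  have comm : ∀ X Y : Set V, IsLongHoleOn G ℓ (X ∪ Y) → IsLongHoleOn G ℓ (Y ∪ X) :=
    fun X Y hXY => by rwa [Set.union_comm]
  let P : ∀ t : Fin 3, G.Walk ((![x, f i, f (i - 1)] : Fin 3 → V) t)
      ((![x, f j, f (j + 1)] : Fin 3 → V) t) := fun t =>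
    match t with
    | 0 => (Walk.nil : G.Walk x x)
    | 1 => P₁
    | 2 => P₂
  refine h.candidate.2 ⟨_, _, P, ?_, ?_, ?_, ?_, ?_, ?_⟩
  · intro s t hst
    match s, t with
    | 0, 0 | 1, 1 | 2, 2 => exact absurd rfl hst
    | 0, 1 => exact hi
    | 1, 0 => exact hi.symm
    | 0, 2 => exact hi'
    | 2, 0 => exact hi'.symm
    | 1, 2 => exact hii
    | 2, 1 => exact hii.symm
  · intro s t hst
    match s, t with
    | 0, 0 | 1, 1 | 2, 2 => exact absurd rfl hst
    | 0, 1 => exact hj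
    | 1, 0 => exact hj.symm
    | 0, 2 => exact hj'
    | 2, 0 => exact hj'.symm
    | 1, 2 => exact hjj
    | 2, 1 => exact hjj.symm
  · have key : ∀ z ∈ Set.range (![x, f i, f (i - 1)] : Fin 3 → V) ∩
        Set.range (![x, f j, f (j + 1)] : Fin 3 → V), z = x := by
      rintro z ⟨hz, hz'⟩
      simp only [Matrix.range_cons, Matrix.range_empty, Set.union_empty, Set.mem_union,
        Set.mem_singleton_iff] at hz hz'
      rcases hz with hz | hz | hz
      · exact hz
      · rcases hz' with hz' | hz' | hz'
        · exact hz'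
        · exact absurd (hz.symm.trans hz') (h.ne _ _ (by omega) (by omega))
        · exact absurd (hz.symm.trans hz') (h.ne _ _ (by omega) (by omega))
      · rcases hz' with hz' | hz' | hz'
        · exact hz'
        · exact absurd (hz.symm.trans hz') (h.ne _ _ (by omega) (by omega))
        · exact absurd (hz.symm.trans hz') (h.ne _ _ (by omega) (by omega))
    intro y hy z hz
    rw [key y hy, key z hz]
  · intro t
    match t with
    | 0 => exact Walk.IsPath.nil
    | 1 => exact hP₁.1
    | 2 => exact hP₂.1
  · intro s t hst z hz hz'
    match s, t with
    | 0, 0 | 1, 1 | 2, 2 => exact hst rfl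
    | 0, 1 => exact hx₁ z (List.mem_singleton.1 hz) hz'
    | 0, 2 => exact hx₂ z (List.mem_singleton.1 hz) hz'
    | 1, 0 => exact hx₁ z (List.mem_singleton.1 hz') hz
    | 2, 0 => exact hx₂ z (List.mem_singleton.1 hz') hz
    | 1, 2 => exact hdisj z hz hz'
    | 2, 1 => exact hdisj z hz' hz
  · intro s t hst
    match s, t with
    | 0, 0 | 1, 1 | 2, 2 => exact absurd rfl hst
    | 0, 1 => exact hole₁
    | 0, 2 => exact hole₂
    | 1, 0 => exact comm _ _ hole₁
    | 2, 0 => exact comm _ _ hole₂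
    | 1, 2 => exact hole₃
    | 2, 1 => exact comm _ _ hole₃

lemma not_two_edges (h : IsShortestParam G ℓ n f x) {i j : ℤ} (hij : i + 2 ≤ j)
    (hji : j + 4 ≤ i + n)
    (hi' : G.Adj x (f (i - 1))) (hi : G.Adj x (f i)) (hj : G.Adj x (f j))
    (hj' : G.Adj x (f (j + 1)))
    (hgap₁ : ∀ k, i < k → k < j → ¬ G.Adj x (f k))
    (hgap₂ : ∀ k, j + 1 < k → k < i - 1 + n → ¬ G.Adj x (f k)) : False := by
  have hn := h.two_mul_lt
  have hl := h.six_le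
  have heven := h.even
  have hin : G.Adj x (f (i + n)) := (h.adj_add i).2 hi
  have hin' : G.Adj x (f (i - 1 + n)) := (h.adj_add _).2 hi'
  rcases Int.emod_two_eq_zero_or_one (j - i) with hp | hp
  · rcases lt_or_ge (j - i + 2) ℓ with hs | hs
    · exact h.not_even_gap (by omega) (by omega) hj' hin' hgap₂ (by omega) (by omega)
    · exact h.not_even_gap hij (by omega) hi hj hgap₁ hp hs
  rcases lt_or_ge (j - i + 2) ℓ with hs | hs
  · exact h.not_odd_arc (by omega) (by omega) (by omega) hi' hj' hgap₂
  rcases lt_or_ge (i + n - j) ℓ with ht | ht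
  · exact h.not_odd_arc (by omega) (by omega) (by omega) hj hin fun k hk₁ hk₂ hk =>
      hgap₁ (k - n) (by omega) (by omega) ((h.adj_sub k).2 hk)
  exact h.not_two_odd_gaps hij hji hs ht hi' hi hj hj' hgap₁ hgap₂

/-- A vertex with neighbours outside every three-vertex path has three pairwise nonadjacent
neighbours. -/
lemma exists_triad (h : IsShortestParam G ℓ n f x)
    (hmajor : ∀ q, ∃ k, q + 2 ≤ k ∧ k + 2 ≤ q + n ∧ G.Adj x (f k)) :
    ∃ i j k, i + 2 ≤ j ∧ j + 2 ≤ k ∧ k + 2 ≤ i + n ∧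
      G.Adj x (f i) ∧ G.Adj x (f j) ∧ G.Adj x (f k) := by
  classical
  have hn := h.two_mul_lt
  have hl := h.six_le
  by_contra! hno
  obtain ⟨s, hs, hs'⟩ : ∃ s, G.Adj x (f s) ∧ ¬ G.Adj x (f (s + 1)) := by
    by_contra! hall
    obtain ⟨k, -, -, hk⟩ := hmajor 0
    have h₂ := hall _ (hall k hk)
    exact hno k (k + 1 + 1) (k + 1 + 1 + 1 + 1) (by omega) (by omega) (by omega) hk h₂
      (hall _ (hall _ h₂))
  have hex : ∃ t : ℕ, G.Adj x (f (s + 2 + t)) := by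
    obtain ⟨k, hk, -, hk'⟩ := hmajor s
    exact ⟨(k - (s + 2)).toNat, by convert hk' using 2; omega⟩
  obtain ⟨a, has, ha, hgap⟩ : ∃ a, s + 2 ≤ a ∧ G.Adj x (f a) ∧
      ∀ k, s < k → k < a → ¬ G.Adj x (f k) := by
    refine ⟨_, by omega, Nat.find_spec hex, fun k hk₁ hk₂ hk => ?_⟩
    rcases eq_or_ne k (s + 1) with rfl | hne
    · exact hs' hk
    · refine Nat.find_min hex (m := (k - (s + 2)).toNat) (by omega) ?_
      convert hk using 2
      omega
  have han : a + 2 ≤ s + n := by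
    by_contra! hlt
    obtain ⟨k, hk₁, hk₂, hk⟩ := hmajor s
    exact hgap k (by omega) (by omega) hk
  have key : ∀ k, s < k → k < s + n → G.Adj x (f k) → k = a ∨ k = a + 1 ∨ k = s + n - 1 := by
    intro k hk₁ hk₂ hk
    by_contra! hne
    rcases lt_or_ge k a with hka | hka
    · exact hgap k hk₁ hka hk
    · exact hno s a k has (by omega) (by omega) hs ha hk
  have hprev : G.Adj x (f (s + n - 1)) ↔ G.Adj x (f (s - 1)) := by
    rw [← h.adj_add (s - 1), show s - 1 + n = s + n - 1 by ring]
  have hsn : G.Adj x (f (s + n)) := (h.adj_add s).2 hs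
  by_cases hA : G.Adj x (f (s - 1)) <;> by_cases hD : G.Adj x (f (a + 1))
  · rcases lt_or_ge (a + 3) (s + n) with ha' | ha'
    · refine h.not_two_edges has (by omega) hA hs ha hD hgap fun k hk₁ hk₂ hk => ?_
      have := key k (by omega) (by omega) hk
      omega
    · rcases ha'.lt_or_eq with ha' | ha'
      · obtain ⟨k, hk₁, hk₂, hk⟩ := hmajor (s - 1)
        rcases lt_trichotomy k s with hks | rfl | hks
        · omega
        · omega
        · have := key k hks (by omega) hk
          omega
      · exact h.not_odd_arc (i := a) (j := s + n) (by omega) (by omega) (by omega) ha hsn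
          fun k hk₁ hk₂ hk => hgap (k - n) (by omega) (by omega) ((h.adj_sub k).2 hk)
  · rcases lt_or_ge (a + 2) (s + n) with ha' | ha'
    · refine h.not_nbr_and_edge (i := a - n) (j := s - 1) (by omega) (by omega)
        ((h.adj_sub a).2 ha) hA (by simpa using hs) (fun k hk₁ hk₂ hk => ?_)
        fun k hk₁ hk₂ hk => hgap k (by omega) (by omega) hk
      have hk' := (h.adj_add k).2 hk
      rcases key (k + n) (by omega) (by omega) hk' with hk₃ | hk₃ | hk₃
      · omega
      · rw [hk₃] at hk'
        exact hD hk'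
      · omega
    · exact hD (by rw [← hprev] at hA; convert hA using 2; omega)
  · rcases lt_or_ge (a + 2) (s + n) with ha' | ha'
    · refine h.not_nbr_and_edge has (by omega) hs ha hD hgap fun k hk₁ hk₂ hk => ?_
      rcases key k (by omega) hk₂ hk with rfl | rfl | rfl
      · omega
      · omega
      · exact hA (hprev.1 hk)
    · exact hA (hprev.1 (by convert hD using 2; omega))
  · have hgap' : ∀ k, a < k → k < s + n → ¬ G.Adj x (f k) := by
      intro k hk₁ hk₂ hk
      rcases key k (by omega) hk₂ hk with rfl | rfl | rfl
      · omega
      · exact hD hk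
      · exact hA (hprev.1 hk)
    refine h.not_two_nbrs ?_ ?_ hs ha hgap hgap'
    · by_contra! hlt
      obtain ⟨k, hk₁, hk₂, hk⟩ := hmajor (s + 1)
      rcases lt_trichotomy k (s + n) with hks | rfl | hks
      · exact hgap' k (by omega) hks hk
      · omega
      · omega
    · by_contra! hlt
      obtain ⟨k, hk₁, hk₂, hk⟩ := hmajor (s - 1)
      exact hgap k (by omega) (by omega) hk

lemma not_odd_nbr_opposite (h : IsShortestParam G ℓ n f x) {m a : ℤ}
    (h₁ : ℓ ≤ a - m + 1) (h₂ : ℓ ≤ m + n - a + 1)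
    (hp : G.Adj x (f (m - 1))) (hr : G.Adj x (f (m + 1))) (ha : G.Adj x (f a))
    (hgap₁ : ∀ k, m + 1 < k → k < a → ¬ G.Adj x (f k))
    (hgap₂ : ∀ k, a < k → k < m - 1 + n → ¬ G.Adj x (f k)) : False := by
  have hn := h.two_mul_lt
  have hl := h.six_le
  obtain ⟨P₁, hP₁, hlen₁, hmem₁⟩ := h.exists_reverse_arc (i := m + 1) (j := a) (by omega)
    (by omega) rfl rfl
  obtain ⟨P₂, hP₂, hlen₂, hmem₂⟩ := h.exists_arc (i := a) (j := m - 1 + n) (by omega)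
    (by omega) rfl (h.periodic (m - 1))
  have hint₁ : ∀ z ∈ inter P₁, ∃ k, m + 1 < k ∧ k < a ∧ z = f k := fun z hz =>
    IsHoleParam.mem_inter_arc (P := P₁.reverse) rfl rfl (by simpa using hmem₁)
      (by simpa [inter, and_comm] using hz)
  have hint₂ : ∀ z ∈ inter P₂, ∃ k, a < k ∧ k < m - 1 + n ∧ z = f k := fun z hz =>
    IsHoleParam.mem_inter_arc rfl (h.periodic (m - 1)) hmem₂ hz
  have hw : G.Adj (f (m - 1)) (f m) := by simpa using h.adj_succ (by omega) (m - 1)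
  refine h.candidate.1.2.2.2 ⟨x, f (m + 1), f m, f (m - 1), f a, P₁, P₂, hr,
    (h.adj_succ (by omega) m).symm, hw.symm, hp.symm,
    fun hadj => h.not_adj (by omega) (by omega) hadj.symm, (h.ne_apex m).symm, ha.symm,
    fun hadj => h.not_adj (by omega) (by omega) hadj.symm,
    fun hadj => h.not_adj (by omega) (by omega) hadj.symm,
    fun hadj => h.not_adj (by omega) (by omega) hadj.symm,
    (h.ne _ _ (by omega) (by omega)).symm, (h.ne _ _ (by omega) (by omega)).symm,
    (h.ne _ _ (by omega) (by omega)).symm, hP₁, hP₂, by omega, by omega, ?_, ?_, ?_,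
    by omega, by omega, by omega⟩
  · intro y hy z hz
    obtain ⟨k, hk₁, hk₂, rfl⟩ := hint₁ y hy
    rcases hz with rfl | rfl
    · exact ⟨h.ne_apex k, fun hadj => hgap₁ k hk₁ hk₂ hadj.symm⟩
    · exact ⟨(h.ne _ _ (by omega) (by omega)).symm,
        fun hadj => h.not_adj (by omega) (by omega) hadj.symm⟩
  · intro y hy z hz
    obtain ⟨k, hk₁, hk₂, rfl⟩ := hint₂ y hy
    rcases hz with rfl | rfl
    · exact ⟨h.ne_apex k, fun hadj => hgap₂ k hk₁ hk₂ hadj.symm⟩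
    · exact ⟨(h.ne _ _ (by omega) (by omega)).symm,
        fun hadj => h.not_adj (by omega) (by omega) hadj.symm⟩
  · refine h.anticomplete_arcs (i := m + 1) (j := a - 1) (k := a + 1) (l := m - 1 + n)
      ?_ ?_ (by omega) (by omega)
    · rintro z ⟨hz, hza⟩
      obtain ⟨k, hk₁, hk₂, rfl⟩ := (hmem₁ z).1 hz
      have : k ≠ a := by rintro rfl; exact hza rfl
      exact ⟨k, by omega, by omega, rfl⟩
    · rintro z ⟨hz, hza⟩
      obtain ⟨k, hk₁, hk₂, rfl⟩ := (hmem₂ z).1 hz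
      have : k ≠ a := by rintro rfl; exact hza rfl
      exact ⟨k, by omega, by omega, rfl⟩

lemma not_nbr_opposite (h : IsShortestParam G ℓ n f x) {m a : ℤ}
    (h₁ : m + 3 ≤ a) (h₂ : a + 3 ≤ m + n)
    (hp : G.Adj x (f (m - 1))) (hr : G.Adj x (f (m + 1))) (ha : G.Adj x (f a))
    (hgap₁ : ∀ k, m + 1 < k → k < a → ¬ G.Adj x (f k))
    (hgap₂ : ∀ k, a < k → k < m - 1 + n → ¬ G.Adj x (f k)) : False := by
  have hn := h.two_mul_lt
  have hl := h.six_le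
  have heven := h.even
  have hpn : G.Adj x (f (m - 1 + n)) := (h.adj_add _).2 hp
  have hrn : G.Adj x (f (m + 1 + n)) := (h.adj_add _).2 hr
  rcases Int.emod_two_eq_zero_or_one (a - (m + 1)) with hpar | hpar
  · rcases lt_or_ge (a - (m + 1) + 2) ℓ with hs | hs
    · exact h.not_even_gap (by omega) (by omega) ha hpn hgap₂ (by omega) (by omega)
    · exact h.not_even_gap (by omega) (by omega) hr ha hgap₁ hpar hs
  rcases lt_or_ge (a - m + 1) ℓ with hs | hs
  · exact h.not_odd_arc (by omega) (by omega) (by omega) hp ha hgap₂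
  rcases lt_or_ge (m + n - a + 1) ℓ with ht | ht
  · exact h.not_odd_arc (by omega) (by omega) (by omega) ha hrn fun k hk₁ hk₂ hk =>
      hgap₁ (k - n) (by omega) (by omega) ((h.adj_sub k).2 hk)
  exact h.not_odd_nbr_opposite hs ht hp hr ha hgap₁ hgap₂

/-- A vertex with neighbours outside every three-vertex path has at least two such
neighbours. -/
lemma exists_two_nbrs (h : IsShortestParam G ℓ n f x)
    (hmajor : ∀ q, ∃ k, q + 2 ≤ k ∧ k + 2 ≤ q + n ∧ G.Adj x (f k)) (m : ℤ) :
    ∃ a b, m + 2 ≤ a ∧ a < b ∧ b + 2 ≤ m + n ∧ G.Adj x (f a) ∧ G.Adj x (f b) := by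
  have hn := h.two_mul_lt
  have hl := h.six_le
  by_contra! hno
  obtain ⟨a, ha₁, ha₂, ha⟩ := hmajor m
  have huniq : ∀ k, m + 2 ≤ k → k + 2 ≤ m + n → G.Adj x (f k) → k = a := by
    intro k hk₁ hk₂ hk
    rcases lt_trichotomy k a with hlt | rfl | hlt
    · exact absurd ha (hno k a hk₁ hlt ha₂ hk)
    · rfl
    · exact absurd hk (hno a k ha₁ hlt hk₂ ha)
  have reduce : ∀ k, G.Adj x (f k) → ∃ k', f k = f k' ∧ G.Adj x (f k') ∧
      (k' = m - 1 ∨ k' = m ∨ k' = m + 1 ∨ k' = a) := by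
    intro k hk
    obtain ⟨k', h₁, h₂, h₃⟩ := h.exists_eq (by omega) k (m - 1)
    rw [h₃] at hk
    refine ⟨k', h₃, hk, ?_⟩
    by_cases hk' : m + 2 ≤ k'
    · have := huniq k' hk' (by omega) hk
      omega
    · omega
  have hadj₁ : G.Adj (f (m - 1)) (f m) := by simpa using h.adj_succ (by omega) (m - 1)
  have hadj₂ : G.Adj (f m) (f (m + 1)) := h.adj_succ (by omega) m
  have hadj₃ : a = m + 2 → G.Adj (f (m + 1)) (f a) := by
    rintro rfl
    simpa [add_assoc] using h.adj_succ (by omega) (m + 1)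
  have hadj₄ : a + 2 = m + n → G.Adj (f a) (f (m - 1)) := by
    intro ha'
    rw [← h.periodic (m - 1), show m - 1 + n = a + 1 by omega]
    exact h.adj_succ (by omega) a
  obtain ⟨hp, hr, h₃, h₄⟩ : G.Adj x (f (m - 1)) ∧ G.Adj x (f (m + 1)) ∧ a ≠ m + 2 ∧
      a + 2 ≠ m + n := by
    obtain ⟨i, j, k, hij, hjk, hki, hi, hj, hk⟩ := h.exists_triad hmajor
    have nij := h.not_adj hij (by omega)
    have njk := h.not_adj hjk (by omega)
    have nik := h.not_adj (i := i) (j := k) (by omega) hki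
    have eij := h.ne i j (by omega) (by omega)
    have ejk := h.ne j k (by omega) (by omega)
    have eik := h.ne i k (by omega) (by omega)
    obtain ⟨i', hi', hi, hi''⟩ := reduce i hi
    obtain ⟨j', hj', hj, hj''⟩ := reduce j hj
    obtain ⟨k', hk', hk, hk''⟩ := reduce k hk
    rw [hi', hj'] at nij eij
    rw [hj', hk'] at njk ejk
    rw [hi', hk'] at nik eik
    clear hi' hj' hk'
    have := hadj₁.symm
    have := hadj₂.symm
    have := fun e => (hadj₃ e).symm
    have := fun e => (hadj₄ e).symm
    rcases hi'' with rfl | rfl | rfl | rfl <;> rcases hj'' with rfl | rfl | rfl | rfl <;>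
      first
        | exact absurd rfl eij
        | contradiction
        | (rcases hk'' with rfl | rfl | rfl | rfl <;>
            first
              | exact absurd rfl eik
              | exact absurd rfl ejk
              | contradiction
              | exact ⟨‹_›, ‹_›, by tauto, by tauto⟩)
  refine h.not_nbr_opposite (by omega) (by omega) hp hr ha (fun k hk₁ hk₂ hk => ?_)
    fun k hk₁ hk₂ hk => ?_
  · have := huniq k (by omega) (by omega) hk
    omega
  · have := huniq k (by omega) (by omega) hk
    omega

end IsShortestParam

end LEH

/-- a `C`-major vertex has three pairwise nonadjacent neighbours on a
shortest long even hole `C` of a candidate, and at least two neighbours outside every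
three-vertex path of `C`. -/
theorem triad {V : Type*} [Fintype V]
    (ℓ : ℕ) (hℓ : 6 ≤ ℓ) (hℓeven : Even ℓ)
    (G : SimpleGraph V) (hG : Candidate G ℓ)
    {u : V} (c : G.Walk u u) (hc : ShortestLEH G ℓ c)
    (x : V) (hx : CMajor G c x) :
    (∃ y₁ y₂ y₃, y₁ ∈ c.support ∧ y₂ ∈ c.support ∧ y₃ ∈ c.support ∧
      G.Adj x y₁ ∧ G.Adj x y₂ ∧ G.Adj x y₃ ∧
      y₁ ≠ y₂ ∧ y₁ ≠ y₃ ∧ y₂ ≠ y₃ ∧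
      ¬ G.Adj y₁ y₂ ∧ ¬ G.Adj y₁ y₃ ∧ ¬ G.Adj y₂ y₃) ∧
    (∀ p q r : V, s(p, q) ∈ c.edges → s(q, r) ∈ c.edges → p ≠ r →
      ∃ z₁ z₂, z₁ ∈ c.support ∧ z₂ ∈ c.support ∧ z₁ ≠ z₂ ∧
        z₁ ∉ ({p, q, r} : Set V) ∧ z₂ ∉ ({p, q, r} : Set V) ∧
        G.Adj x z₁ ∧ G.Adj x z₂) := by
  obtain ⟨f, hf, hsupp⟩ := hc.1.1.exists_param
  have hnlt : 2 * ℓ < c.length := by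
    by_contra! hle
    exact hG.1.1 ⟨u, c, hc.1, hle⟩
  have hpar : IsShortestParam G ℓ c.length f x :=
    { toIsHoleParam := hf
      candidate := hG
      six_le := hℓ
      two_mul_lt := by exact_mod_cast hnlt
      even := by have := Nat.even_iff.1 hc.1.2.2; omega
      ne_apex := fun k hk => hx.1 ((hsupp x).2 ⟨k, hk.symm⟩)
      le_length := fun v c' hc' => by exact_mod_cast hc.2 v c' hc' }
  have hedge : ∀ y ∈ c.support, ∀ z ∈ c.support, s(y, z) ∈ c.edges ↔ G.Adj y z :=
    fun y hy z hz => ⟨fun h => c.adj_of_mem_edges h, hc.1.1.2.2 y hy z hz⟩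
  have hmem : ∀ k, f k ∈ c.support := fun k => (hsupp _).2 ⟨k, rfl⟩
  have hmajor : ∀ q : ℤ, ∃ k, q + 2 ≤ k ∧ k + 2 ≤ q + c.length ∧ G.Adj x (f k) := by
    intro q
    by_contra! hno
    refine hx.2 ⟨f q, hmem q, fun z hz hxz => ?_⟩
    obtain ⟨k, rfl⟩ := (hsupp z).1 hz
    obtain ⟨k', h₁, h₂, h₃⟩ := hf.exists_eq (by omega) k q
    rw [h₃] at hxz ⊢
    rw [hedge _ (hmem q) _ (hmem k')]
    rcases h₁.eq_or_lt with rfl | h₁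
    · exact .inl rfl
    · right
      rw [hf.adj_iff q k' h₁ h₂]
      by_contra! hne
      exact hno k' (by omega) (by omega) hxz
  refine ⟨?_, fun p q r hpq hqr _ => ?_⟩
  · obtain ⟨i, j, k, hij, hjk, hki, hi, hj, hk⟩ := hpar.exists_triad hmajor
    exact ⟨f i, f j, f k, hmem i, hmem j, hmem k, hi, hj, hk,
      hf.ne _ _ (by omega) (by omega), hf.ne _ _ (by omega) (by omega),
      hf.ne _ _ (by omega) (by omega), hf.not_adj hij (by omega),
      hf.not_adj (by omega) hki, hf.not_adj hjk (by omega)⟩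
  · obtain ⟨m, rfl⟩ := (hsupp q).1 (c.snd_mem_support_of_mem_edges hpq)
    have hp := c.adj_of_mem_edges hpq
    have hr := c.adj_of_mem_edges hqr
    obtain ⟨a, b, ha₁, hab, hb₁, ha, hb⟩ := hpar.exists_two_nbrs hmajor m
    have avoid : ∀ k, m + 2 ≤ k → k + 2 ≤ m + c.length →
        f k ∉ ({p, f m, r} : Set V) := by
      rintro k hk₁ hk₂ (hk | hk | hk)
      · rw [← hk] at hp
        exact hf.not_adj hk₁ hk₂ hp.symm
      · exact hf.ne m k (by omega) (by omega) hk.symm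
      · rw [← (show f k = r from hk)] at hr
        exact hf.not_adj hk₁ hk₂ hr
    exact ⟨f a, f b, hmem a, hmem b, hf.ne _ _ hab (by omega), avoid a ha₁ (by omega),
      avoid b (by omega) hb₁, ha, hb⟩
end
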